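/- arXiv:2602.10322 — 4 statements merged into one kernel-verified Lean document; each statement's English description precedes it below -/
import Mathlib

section
/- Boundary determination for gauge-corrected one-forms: let f₁, …, f_{n−1} be real-valued functions on [0,ε) × U that extend to C^∞ functions on an open neighborhood of [0,ε) × U in ℝ × ℝ^{n-1} (the tangential components of a one-form whose dx-component vanishes identically), and let V ⊆ U be open. Suppose there exists s₀ > 0 such that (i) for every y₀ ∈ V, every η₀ ∈ ℝ^{n-1} with ⟨A(0,y₀)η₀, η₀⟩ = 1, and every s ∈ (0,s₀) there exists a short-geodesic trajectory with data (y₀, η₀, s), and (ii) every such short-geodesic trajectory satisfies ∫₀^T Σ_{i=1}^{n-1} f_i(x(t),y(t)) · (x(t)² A(x(t),y(t)) η(t))_i dt = 0 (vanishing of the geodesic X-ray transform of the one-form along these geodesics). Then ∂_x^k f_i(0,y) = 0 for every integer k ≥ 0, every i = 1,…,n−1, and every y ∈ V. -/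
open Set

noncomputable section

/-- `quadForm M v w = ⟨M v, w⟩`, the bilinear form of the matrix `M` with respect to the
standard inner product on `ℝ^m`. -/
def quadForm {m : ℕ} (M : Matrix (Fin m) (Fin m) ℝ) (v w : Fin m → ℝ) : ℝ :=
  ∑ i, (∑ j, M i j * v j) * w i

/-- The Euclidean norm of a vector in `ℝ^m`. -/
def euclNorm {m : ℕ} (v : Fin m → ℝ) : ℝ :=
  Real.sqrt (∑ i, v i ^ 2)

/-- Entrywise partial derivative `∂ₓ A` of a matrix-valued map in its first (scalar) variable. -/
def dxA {m : ℕ} (A : ℝ → (Fin m → ℝ) → Matrix (Fin m) (Fin m) ℝ)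
    (x : ℝ) (y : Fin m → ℝ) : Matrix (Fin m) (Fin m) ℝ :=
  Matrix.of fun i j => deriv (fun x' => A x' y i j) x

/-- Entrywise partial derivative `∂_{y k} A` of a matrix-valued map in the `k`-th component of
its second (vector) variable. -/
def dyA {m : ℕ} (A : ℝ → (Fin m → ℝ) → Matrix (Fin m) (Fin m) ℝ)
    (k : Fin m) (x : ℝ) (y : Fin m → ℝ) : Matrix (Fin m) (Fin m) ℝ :=
  Matrix.of fun i j => deriv (fun s => A x (Function.update y k s) i j) (y k)

/-- Partial derivative `∂ₓ f` of a scalar function of `(x, y)`. -/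
def dxF {m : ℕ} (f : ℝ → (Fin m → ℝ) → ℝ) (x : ℝ) (y : Fin m → ℝ) : ℝ :=
  deriv (fun x' => f x' y) x

/-- Partial derivative `∂_{y k} f` of a scalar function of `(x, y)`. -/
def dyF {m : ℕ} (f : ℝ → (Fin m → ℝ) → ℝ) (k : Fin m) (x : ℝ) (y : Fin m → ℝ) : ℝ :=
  deriv (fun s => f x (Function.update y k s)) (y k)

/-- Iterated partial derivative `∂ₓ^k f` of a scalar function of `(x, y)`. -/
def dxIter {m : ℕ} : ℕ → (ℝ → (Fin m → ℝ) → ℝ) → ℝ → (Fin m → ℝ) → ℝ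
  | 0, f => f
  | (k+1), f => dxF (dxIter k f)

/-- The standing hypotheses on the data of a gas giant in `g`-boundary normal coordinates:
`n ≥ 2`, `ε ∈ (0,1]`, `U ⊆ ℝ^{n-1}` open, and `A : [0,ε) × U → ℝ^{(n-1)×(n-1)}` symmetric
positive definite (with uniform ellipticity constants `0 < lam ≤ Lam`), extending to a `C^∞`
map on an open neighborhood of `[0,ε) × U`, with all first-order partial derivatives of all
entries bounded by `Lam`.  (`A` plays the role of the inverse boundary metric `h^{ij}` of the
gas giant metric `g = dx² + x⁻² h(x,y,dy)`.) -/
structure GasGiantData (n : ℕ) (ε : ℝ) (U : Set (Fin (n-1) → ℝ))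
    (A : ℝ → (Fin (n-1) → ℝ) → Matrix (Fin (n-1)) (Fin (n-1)) ℝ)
    (lam Lam : ℝ) : Prop where
  hn : 2 ≤ n
  hε : ε ∈ Set.Ioc (0:ℝ) 1
  hU : IsOpen U
  hlam : 0 < lam
  hlamLam : lam ≤ Lam
  hsymm : ∀ x ∈ Set.Ico (0:ℝ) ε, ∀ y ∈ U, (A x y).IsSymm
  hsmooth : ∃ W : Set (ℝ × (Fin (n-1) → ℝ)), IsOpen W ∧ Set.Ico (0:ℝ) ε ×ˢ U ⊆ W ∧
    ∀ i j, ContDiffOn ℝ (⊤ : ℕ∞) (fun p : ℝ × (Fin (n-1) → ℝ) => A p.1 p.2 i j) W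
  hposdef : ∀ x ∈ Set.Ico (0:ℝ) ε, ∀ y ∈ U, ∀ v : Fin (n-1) → ℝ,
    lam * (∑ i, v i ^ 2) ≤ quadForm (A x y) v v ∧ quadForm (A x y) v v ≤ Lam * (∑ i, v i ^ 2)
  hderivBound : ∀ x ∈ Set.Ico (0:ℝ) ε, ∀ y ∈ U,
    (∀ i j, |dxA A x y i j| ≤ Lam) ∧ (∀ k i j, |dyA A k x y i j| ≤ Lam)

/-- A Hamiltonian trajectory on the interval `I` for the gas giant Hamiltonian
`H(x,y,ξ,η) = ½ ξ² + ½ x² ⟨A(x,y)η, η⟩`: a `C¹` curve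
`t ↦ (x(t), y(t), ξ(t), η(t)) ∈ [0,ε) × U × ℝ × ℝ^{n-1}` satisfying Hamilton's equations. -/
structure IsHamTraj (n : ℕ) (ε : ℝ) (U : Set (Fin (n-1) → ℝ))
    (A : ℝ → (Fin (n-1) → ℝ) → Matrix (Fin (n-1)) (Fin (n-1)) ℝ) (I : Set ℝ)
    (x : ℝ → ℝ) (y : ℝ → Fin (n-1) → ℝ) (ξ : ℝ → ℝ) (η : ℝ → Fin (n-1) → ℝ) : Prop where
  mem : ∀ t ∈ I, x t ∈ Set.Ico (0:ℝ) ε ∧ y t ∈ U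
  hx : ∀ t ∈ I, HasDerivAt x (ξ t) t
  hy : ∀ t ∈ I, ∀ i, HasDerivAt (fun t' => y t' i)
    ((x t)^2 * ∑ j, A (x t) (y t) i j * η t j) t
  hxi : ∀ t ∈ I, HasDerivAt ξ
    (-(x t * quadForm (A (x t) (y t)) (η t) (η t))
      - (1/2) * (x t)^2 * quadForm (dxA A (x t) (y t)) (η t) (η t)) t
  heta : ∀ t ∈ I, ∀ i, HasDerivAt (fun t' => η t' i)
    (-(1/2) * (x t)^2 * quadForm (dyA A i (x t) (y t)) (η t) (η t)) t

/-- A short-geodesic trajectory with data `(y₀, η₀, s)`: a Hamiltonian trajectory on `[0,T]`,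
`T > 0`, with initial value `(0, y₀, s, η₀)`, with `x(T) = 0` and `x(t) > 0` on `(0,T)`. -/
def IsShortGeo (n : ℕ) (ε : ℝ) (U : Set (Fin (n-1) → ℝ))
    (A : ℝ → (Fin (n-1) → ℝ) → Matrix (Fin (n-1)) (Fin (n-1)) ℝ)
    (y₀ η₀ : Fin (n-1) → ℝ) (s T : ℝ)
    (x : ℝ → ℝ) (y : ℝ → Fin (n-1) → ℝ) (ξ : ℝ → ℝ) (η : ℝ → Fin (n-1) → ℝ) : Prop :=
  0 < T ∧ IsHamTraj n ε U A (Set.Icc 0 T) x y ξ η ∧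
    x 0 = 0 ∧ y 0 = y₀ ∧ ξ 0 = s ∧ η 0 = η₀ ∧ x T = 0 ∧ ∀ t ∈ Set.Ioo 0 T, 0 < x t

/-- A function with nonpositive derivative on `[a, b]` does not increase from `a` to `b`. -/
lemma le_left_of_hasDerivAt_nonpos {g g' : ℝ → ℝ} {a b : ℝ} (hab : a ≤ b)
    (hg : ∀ t ∈ Icc a b, HasDerivAt g (g' t) t) (hg' : ∀ t ∈ Icc a b, g' t ≤ 0) :
    g b ≤ g a := by
  have h : AntitoneOn g (Icc a b) := by
    refine antitoneOn_of_deriv_nonpos (convex_Icc a b)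
      (fun t ht => (hg t ht).continuousAt.continuousWithinAt)
      (fun t ht => (hg t (interior_subset ht)).differentiableAt.differentiableWithinAt) ?_
    intro t ht
    rw [(hg t (interior_subset ht)).deriv]
    exact hg' t (interior_subset ht)
  exact h (left_mem_Icc.2 hab) (right_mem_Icc.2 hab) hab

/-- Bounds for a nonnegative solution of `x'' = -q x` with `1/2 ≤ q ≤ 2`, `x 0 = 0`, `x' 0 = s`. -/
lemma oscillator_bounds {x ξ q : ℝ → ℝ} {s τ : ℝ} (hs : 0 ≤ s) (hτ : 0 ≤ τ)
    (hx : ∀ t ∈ Icc 0 τ, HasDerivAt x (ξ t) t)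
    (hξ : ∀ t ∈ Icc 0 τ, HasDerivAt ξ (-(x t * q t)) t)
    (hpos : ∀ t ∈ Icc 0 τ, 0 ≤ x t) (hq : ∀ t ∈ Icc 0 τ, 1 / 2 ≤ q t ∧ q t ≤ 2)
    (hx0 : x 0 = 0) (hξ0 : ξ 0 = s) : x τ ≤ 2 * s ∧ -(2 * s) ≤ ξ τ := by
  have anti : ∀ a b, 0 ≤ a → a ≤ b → b ≤ τ → ξ b ≤ ξ a := by
    intro a b ha hab hb
    have hsub : ∀ t ∈ Icc a b, t ∈ Icc 0 τ := fun t ht => ⟨ha.trans ht.1, ht.2.trans hb⟩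
    refine le_left_of_hasDerivAt_nonpos hab (fun t ht => hξ t (hsub t ht)) fun t ht => ?_
    have h1 := hpos t (hsub t ht)
    have h2 := (hq t (hsub t ht)).1
    nlinarith
  have energy : ∀ κ a b, 0 ≤ a → a ≤ b → b ≤ τ →
      (∀ t ∈ Icc a b, ξ t * (κ * x t - x t * q t) ≤ 0) →
      ξ b ^ 2 + κ * x b ^ 2 ≤ ξ a ^ 2 + κ * x a ^ 2 := by
    intro κ a b ha hab hb hsign
    have hsub : ∀ t ∈ Icc a b, t ∈ Icc 0 τ := fun t ht => ⟨ha.trans ht.1, ht.2.trans hb⟩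
    refine le_left_of_hasDerivAt_nonpos (g := fun t => ξ t ^ 2 + κ * x t ^ 2) hab
      (fun t ht => ((hξ t (hsub t ht)).pow 2).add
        (((hx t (hsub t ht)).pow 2).const_mul κ)) fun t ht => ?_
    have := hsign t ht
    norm_num
    nlinarith
  have rising : ∀ b, 0 ≤ b → b ≤ τ → 0 ≤ ξ b → x b ^ 2 ≤ 2 * s ^ 2 := by
    intro b hb hbτ hξb
    have h := energy (1 / 2) 0 b le_rfl hb hbτ fun t ht => by
      have htτ : t ∈ Icc 0 τ := ⟨ht.1, ht.2.trans hbτ⟩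
      have h1 : 0 ≤ ξ t := hξb.trans (anti t b ht.1 ht.2 hbτ)
      refine mul_nonpos_of_nonneg_of_nonpos h1 ?_
      nlinarith [hpos t htτ, (hq t htτ).1]
    rw [hx0, hξ0] at h
    nlinarith [sq_nonneg (ξ b)]
  have hττ : τ ∈ Icc 0 τ := ⟨hτ, le_rfl⟩
  rcases le_total 0 (ξ τ) with h0 | h0
  · have := rising τ hτ le_rfl h0
    exact ⟨by nlinarith [hpos τ hττ], by linarith⟩
  · obtain ⟨a, ha, hξa⟩ : (0 : ℝ) ∈ ξ '' Icc 0 τ :=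
      intermediate_value_Icc' hτ
        (fun t ht => (hξ t ht).continuousAt.continuousWithinAt) ⟨h0, hξ0 ▸ hs⟩
    have hxa := rising a ha.1 ha.2 hξa.ge
    have h := energy 2 a τ ha.1 ha.2 le_rfl fun t ht => by
      have htτ : t ∈ Icc 0 τ := ⟨ha.1.trans ht.1, ht.2⟩
      have h1 : ξ t ≤ 0 := hξa ▸ anti a t ha.1 ht.1 ht.2
      refine mul_nonpos_of_nonpos_of_nonneg h1 ?_
      nlinarith [hpos t htτ, (hq t htτ).2]
    rw [hξa] at h
    have h3 : ξ τ ^ 2 ≤ 4 * s ^ 2 := by nlinarith [sq_nonneg (x τ)]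
    have h4 : x τ ^ 2 ≤ 2 * s ^ 2 := by nlinarith [sq_nonneg (ξ τ)]
    exact ⟨by nlinarith [hpos τ hττ], by nlinarith⟩

/-- A quantity driven at rate at most `C x²` by such an oscillator moves by at most `12 C s²`. -/
lemma oscillator_drift {x ξ q u u' : ℝ → ℝ} {s τ C : ℝ} (hs : 0 ≤ s) (hτ : 0 ≤ τ) (hC : 0 ≤ C)
    (hx : ∀ t ∈ Icc 0 τ, HasDerivAt x (ξ t) t)
    (hξ : ∀ t ∈ Icc 0 τ, HasDerivAt ξ (-(x t * q t)) t)
    (hpos : ∀ t ∈ Icc 0 τ, 0 ≤ x t) (hq : ∀ t ∈ Icc 0 τ, 1 / 2 ≤ q t ∧ q t ≤ 2)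
    (hx0 : x 0 = 0) (hξ0 : ξ 0 = s)
    (hu : ∀ t ∈ Icc 0 τ, HasDerivAt u (u' t) t) (hu' : ∀ t ∈ Icc 0 τ, |u' t| ≤ C * x t ^ 2) :
    |u τ - u 0| ≤ 12 * C * s ^ 2 := by
  have hxs : ∀ t ∈ Icc 0 τ, x t ≤ 2 * s := fun t ht => by
    have hsub : ∀ r ∈ Icc 0 t, r ∈ Icc 0 τ := fun r hr => ⟨hr.1, hr.2.trans ht.2⟩
    exact (oscillator_bounds hs ht.1 (fun r hr => hx r (hsub r hr))
      (fun r hr => hξ r (hsub r hr)) (fun r hr => hpos r (hsub r hr))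
      (fun r hr => hq r (hsub r hr)) hx0 hξ0).1
  have hξτ := (oscillator_bounds hs hτ hx hξ hpos hq hx0 hξ0).2
  have hbd : ∀ t ∈ Icc 0 τ, C * x t ^ 2 ≤ 4 * C * s * (x t * q t) := fun t ht => by
    have h1 := hpos t ht
    have h2 := hxs t ht
    have h3 := (hq t ht).1
    have h4 : C * x t * x t ≤ C * x t * (2 * s) :=
      mul_le_mul_of_nonneg_left h2 (mul_nonneg hC h1)
    have h5 : C * x t * s * (1 / 2) ≤ C * x t * s * q t :=
      mul_le_mul_of_nonneg_left h3 (mul_nonneg (mul_nonneg hC h1) hs)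
    nlinarith
  have hup := le_left_of_hasDerivAt_nonpos (g := fun t => u t + 4 * C * s * ξ t) hτ
    (fun t ht => (hu t ht).add ((hξ t ht).const_mul (4 * C * s))) fun t ht => by
      linarith [hbd t ht, hu' t ht, le_abs_self (u' t)]
  have hdown := le_left_of_hasDerivAt_nonpos (g := fun t => -u t + 4 * C * s * ξ t) hτ
    (fun t ht => (hu t ht).neg.add ((hξ t ht).const_mul (4 * C * s))) fun t ht => by
      linarith [hbd t ht, hu' t ht, neg_le_abs (u' t)]
  have hCs : 0 ≤ C * s := mul_nonneg hC hs
  have key : 4 * C * s * ξ 0 - 4 * C * s * ξ τ ≤ 12 * C * s ^ 2 := by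
    rw [hξ0]; nlinarith
  rw [abs_le]
  constructor
  · linarith
  · linarith

/-- Continuous bootstrap: a strict bound that improves itself propagates along `[0, T]`. -/
lemma bootstrap_lt {φ : ℝ → ℝ} {T r : ℝ} (hφ : ContinuousOn φ (Icc 0 T)) (h0 : φ 0 < r)
    (hstep : ∀ τ ∈ Icc 0 T, (∀ t ∈ Icc 0 τ, φ t ≤ r) → φ τ < r) :
    ∀ t ∈ Icc 0 T, φ t < r := by
  by_contra! hne
  obtain ⟨t₁, ht₁, hr₁⟩ := hne
  have hit : ∀ t ∈ Icc 0 T, r ≤ φ t → ∃ a ∈ Icc 0 t, φ a = r := fun t ht hr =>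
    intermediate_value_Icc ht.1 (hφ.mono (Icc_subset_Icc_right ht.2)) ⟨h0.le, hr⟩
  have hcomp : IsCompact (Icc 0 T ∩ φ ⁻¹' {r}) :=
    isCompact_Icc.of_isClosed_subset
      (hφ.preimage_isClosed_of_isClosed isClosed_Icc isClosed_singleton) inter_subset_left
  obtain ⟨a, ha, hae⟩ := hit t₁ ht₁ hr₁
  obtain ⟨τ, ⟨hτ, hτr⟩, hmin⟩ :=
    hcomp.exists_isLeast ⟨a, ⟨ha.1, ha.2.trans ht₁.2⟩, hae⟩
  refine (hstep τ hτ fun t ht => ?_).ne hτr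
  by_contra! hlt
  have htT : t ∈ Icc 0 T := ⟨ht.1, ht.2.trans hτ.2⟩
  obtain ⟨b, hb, hbe⟩ := hit t htT hlt.le
  have hτb : τ ≤ b := hmin ⟨⟨hb.1, hb.2.trans htT.2⟩, hbe⟩
  have htτ : t = τ := le_antisymm ht.2 (hτb.trans hb.2)
  rw [htτ] at hlt
  exact hlt.ne' hτr

/-- Taylor's formula with Lagrange remainder when all derivatives below order `k` vanish. -/
lemma exists_eq_mul_pow_div_factorial (k : ℕ) :
    ∀ (g : ℕ → ℝ → ℝ) (x : ℝ), 0 < x →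
      (∀ j, ∀ z ∈ Icc 0 x, HasDerivAt (g j) (g (j + 1) z) z) → (∀ j < k, g j 0 = 0) →
      ∃ z ∈ Ioc 0 x, g 0 x = g k z * (x ^ k / (k.factorial : ℝ)) := by
  induction k with
  | zero => exact fun g x hx _ _ => ⟨x, ⟨hx, le_rfl⟩, by simp⟩
  | succ k ih =>
    intro g x hx hg h0
    obtain ⟨z, hz, hzeq⟩ := exists_ratio_hasDerivAt_eq_ratio_slope (g 0) (g 1) hx
      (fun z hz => (hg 0 z hz).continuousAt.continuousWithinAt)
      (fun z hz => hg 0 z (Ioo_subset_Icc_self hz))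
      (fun z => z ^ (k + 1)) (fun z => ((k + 1 : ℕ) : ℝ) * z ^ k)
      (by fun_prop) (fun z _ => by simpa using hasDerivAt_pow (k + 1) z)
    obtain ⟨w, hw, hweq⟩ := ih (fun j => g (j + 1)) z hz.1
      (fun j a ha => hg (j + 1) a ⟨ha.1, ha.2.trans hz.2.le⟩) (fun j hj => h0 (j + 1) (by omega))
    refine ⟨w, ⟨hw.1, hw.2.trans hz.2.le⟩, ?_⟩
    have hzk : z ^ k ≠ 0 := (pow_pos hz.1 k).ne'
    have hk : (k.factorial : ℝ) ≠ 0 := by positivity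
    have hk1 : ((k : ℝ) + 1) ≠ 0 := by positivity
    simp only [zero_add] at hweq
    rw [h0 0 (by omega), hweq] at hzeq
    simp only [Nat.factorial_succ, Nat.cast_mul, Nat.cast_add, Nat.cast_one] at hzeq ⊢
    have h1 : z ^ k * (g (k + 1) w * x ^ (k + 1)) =
        z ^ k * (g 0 x * ((k + 1) * k.factorial)) := by
      rw [zero_pow (Nat.succ_ne_zero k)] at hzeq
      field_simp at hzeq
      linear_combination z ^ k * hzeq
    have h2 := mul_left_cancel₀ hzk h1
    field_simp
    linear_combination -h2

section
variable {m : ℕ}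

/-- The slice `x ↦ F x y` of a function smooth on an open set has derivative `DF (1, 0)`. -/
lemma hasDerivAt_slice {F : ℝ → (Fin m → ℝ) → ℝ} {W : Set (ℝ × (Fin m → ℝ))} (hW : IsOpen W)
    (hF : ContDiffOn ℝ (⊤ : ℕ∞) (fun p : ℝ × (Fin m → ℝ) => F p.1 p.2) W) {x : ℝ}
    {y : Fin m → ℝ} (h : (x, y) ∈ W) :
    HasDerivAt (fun x' => F x' y)
      (fderiv ℝ (fun p : ℝ × (Fin m → ℝ) => F p.1 p.2) (x, y) (1, 0)) x := by
  have h1 : HasFDerivAt (fun p : ℝ × (Fin m → ℝ) => F p.1 p.2) _ (x, y) :=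
    ((hF.contDiffAt (hW.mem_nhds h)).differentiableAt (by simp)).hasFDerivAt
  have h2 : HasDerivAt (fun x' : ℝ => (x', y)) ((1 : ℝ), (0 : Fin m → ℝ)) x :=
    (hasDerivAt_id x).prodMk (hasDerivAt_const x y)
  exact HasFDerivAt.comp_hasDerivAt (l := fun p : ℝ × (Fin m → ℝ) => F p.1 p.2) x h1 h2

lemma hasDerivAt_dxF {F : ℝ → (Fin m → ℝ) → ℝ} {W : Set (ℝ × (Fin m → ℝ))} (hW : IsOpen W)
    (hF : ContDiffOn ℝ (⊤ : ℕ∞) (fun p : ℝ × (Fin m → ℝ) => F p.1 p.2) W) {x : ℝ}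
    {y : Fin m → ℝ} (h : (x, y) ∈ W) : HasDerivAt (fun x' => F x' y) (dxF F x y) x :=
  (hasDerivAt_slice hW hF h).differentiableAt.hasDerivAt

lemma contDiffOn_dxIter {F : ℝ → (Fin m → ℝ) → ℝ} {W : Set (ℝ × (Fin m → ℝ))} (hW : IsOpen W)
    (hF : ContDiffOn ℝ (⊤ : ℕ∞) (fun p : ℝ × (Fin m → ℝ) => F p.1 p.2) W) (k : ℕ) :
    ContDiffOn ℝ (⊤ : ℕ∞) (fun p : ℝ × (Fin m → ℝ) => dxIter k F p.1 p.2) W := by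
  induction k with
  | zero => exact hF
  | succ k ih =>
    have h1 := (ih.fderiv_of_isOpen hW (m := (⊤ : ℕ∞)) (by simp)).clm_apply
      (contDiffOn_const (c := ((1 : ℝ), (0 : Fin m → ℝ))))
    refine h1.congr fun p hp => ?_
    exact (hasDerivAt_dxF hW ih (x := p.1) (y := p.2) hp).unique (hasDerivAt_slice hW ih hp)

lemma abs_quadForm_le {M : Matrix (Fin m) (Fin m) ℝ} {L : ℝ} (hM : ∀ i j, |M i j| ≤ L)
    (v : Fin m → ℝ) : |quadForm M v v| ≤ L * (∑ i, |v i|) ^ 2 := by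
  calc |quadForm M v v| ≤ ∑ i, |(∑ j, M i j * v j) * v i| := Finset.abs_sum_le_sum_abs _ _
    _ ≤ ∑ i, (L * ∑ j, |v j|) * |v i| := by
        refine Finset.sum_le_sum fun i _ => ?_
        rw [abs_mul]
        refine mul_le_mul_of_nonneg_right ?_ (abs_nonneg _)
        calc |∑ j, M i j * v j| ≤ ∑ j, |M i j * v j| := Finset.abs_sum_le_sum_abs _ _
          _ ≤ ∑ j, L * |v j| := Finset.sum_le_sum fun j _ => by
              rw [abs_mul]; exact mul_le_mul_of_nonneg_right (hM i j) (abs_nonneg _)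
          _ = L * ∑ j, |v j| := (Finset.mul_sum _ _ _).symm
    _ = L * (∑ i, |v i|) ^ 2 := by rw [← Finset.mul_sum]; ring

end

section
variable {n : ℕ} {ε : ℝ} {U : Set (Fin (n-1) → ℝ)}
  {A : ℝ → (Fin (n-1) → ℝ) → Matrix (Fin (n-1)) (Fin (n-1)) ℝ} {lam Lam : ℝ}

lemma GasGiantData.continuousAt_entry (hGG : GasGiantData n ε U A lam Lam) {x : ℝ}
    {y : Fin (n-1) → ℝ} (hx : x ∈ Ico 0 ε) (hy : y ∈ U) (i j : Fin (n-1)) :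
    ContinuousAt (fun p : ℝ × (Fin (n-1) → ℝ) => A p.1 p.2 i j) (x, y) := by
  obtain ⟨W, hW, hsub, hA⟩ := hGG.hsmooth
  exact (hA i j).continuousOn.continuousAt (hW.mem_nhds (hsub ⟨hx, hy⟩))

lemma GasGiantData.continuousAt_mulVec (hGG : GasGiantData n ε U A lam Lam) {x : ℝ}
    {y : Fin (n-1) → ℝ} (hx : x ∈ Ico 0 ε) (hy : y ∈ U) (η : Fin (n-1) → ℝ) :
    ContinuousAt (fun (p : ℝ × (Fin (n-1) → ℝ) × (Fin (n-1) → ℝ)) (i : Fin (n-1)) =>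
      ∑ j, A p.1 p.2.1 i j * p.2.2 j) (x, y, η) := by
  refine continuousAt_pi.2 fun i => tendsto_finsetSum _ fun j _ => ?_
  have h1 : ContinuousAt (fun p : ℝ × (Fin (n-1) → ℝ) × (Fin (n-1) → ℝ) => A p.1 p.2.1 i j)
      (x, y, η) :=
    ContinuousAt.comp (f := fun p : ℝ × (Fin (n-1) → ℝ) × (Fin (n-1) → ℝ) => (p.1, p.2.1))
      (g := fun p : ℝ × (Fin (n-1) → ℝ) => A p.1 p.2 i j)
      (hGG.continuousAt_entry hx hy i j) (by fun_prop)
  have h2 : ContinuousAt (fun p : ℝ × (Fin (n-1) → ℝ) × (Fin (n-1) → ℝ) => p.2.2 j)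
      (x, y, η) := by fun_prop
  exact h1.mul h2

lemma IsHamTraj.continuousAt {I : Set ℝ} {x : ℝ → ℝ} {y : ℝ → Fin (n-1) → ℝ} {ξ : ℝ → ℝ}
    {η : ℝ → Fin (n-1) → ℝ} (h : IsHamTraj n ε U A I x y ξ η) {t : ℝ} (ht : t ∈ I) :
    ContinuousAt (fun t => (x t, y t, η t)) t :=
  (h.hx t ht).continuousAt.prodMk
    ((continuousAt_pi.2 fun i => (h.hy t ht i).continuousAt).prodMk
      (continuousAt_pi.2 fun i => (h.heta t ht i).continuousAt))

/-- Short geodesics with small initial speed `s` stay close to their initial point. -/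
lemma GasGiantData.exists_confined (hGG : GasGiantData n ε U A lam Lam) {y₀ η₀ : Fin (n-1) → ℝ}
    (hy₀ : y₀ ∈ U) (hη₀ : quadForm (A 0 y₀) η₀ η₀ = 1) {r : ℝ} (hr : 0 < r) :
    ∃ s₁ > 0, ∀ s ∈ Ioo 0 s₁, ∀ T x y ξ η, IsShortGeo n ε U A y₀ η₀ s T x y ξ η →
      ∀ t ∈ Icc 0 T, dist (x t, y t, η t) (0, y₀, η₀) < r := by
  have h0ε : (0 : ℝ) ∈ Ico 0 ε := ⟨le_rfl, hGG.hε.1⟩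
  have hLam : 0 ≤ Lam := hGG.hlam.le.trans hGG.hlamLam
  set p₀ : ℝ × (Fin (n-1) → ℝ) × (Fin (n-1) → ℝ) := (0, y₀, η₀) with hp₀
  set Y : ℝ × (Fin (n-1) → ℝ) × (Fin (n-1) → ℝ) → Fin (n-1) → ℝ :=
    fun p i => ∑ j, A p.1 p.2.1 i j * p.2.2 j
  have hY : ContinuousAt Y p₀ := hGG.continuousAt_mulVec h0ε hy₀ η₀
  set B : ℝ × (Fin (n-1) → ℝ) × (Fin (n-1) → ℝ) → ℝ :=
    fun p => Lam * (∑ i, |p.2.2 i|) ^ 2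
  have hB : Continuous B := by fun_prop
  have hQ : ContinuousAt (fun p => quadForm (A p.1 p.2.1) p.2.2 p.2.2) p₀ := by
    refine tendsto_finsetSum _ fun i _ => ?_
    have h2 : ContinuousAt (fun p : ℝ × (Fin (n-1) → ℝ) × (Fin (n-1) → ℝ) => p.2.2 i) p₀ := by
      fun_prop
    exact (continuousAt_pi.1 hY i).mul h2
  set C : ℝ := (B p₀ + 1) + (‖Y p₀‖ + 1) with hCdef
  have hB0 : ∀ p, 0 ≤ B p := fun p => mul_nonneg hLam (sq_nonneg _)
  have hC : 0 < C := by have := hB0 p₀; positivity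
  have hxB : ContinuousAt (fun p => p.1 * B p) p₀ := by fun_prop
  have hev : ∀ᶠ p in nhds p₀, 3 / 4 < quadForm (A p.1 p.2.1) p.2.2 p.2.2 ∧
      quadForm (A p.1 p.2.1) p.2.2 p.2.2 < 3 / 2 ∧ p.1 * B p < 1 / 2 ∧ B p < B p₀ + 1 ∧
      ‖Y p‖ < ‖Y p₀‖ + 1 := by
    refine (hQ.eventually_const_lt ?_).and ((hQ.eventually_lt_const ?_).and
      ((hxB.eventually_lt_const ?_).and ((hB.continuousAt.eventually_lt_const (by linarith)).and
      (hY.norm.eventually_lt_const (by linarith)))))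
    · simp only [hp₀, hη₀]; norm_num
    · simp only [hp₀, hη₀]; norm_num
    · simp [hp₀]
  obtain ⟨ρ, hρ, hball⟩ := Metric.eventually_nhds_iff.1 hev
  set r' : ℝ := min r ρ / 2 with hr'def
  have hr' : 0 < r' := by positivity
  have hr'r : r' < r := by
    have := min_le_left r ρ
    linarith
  have hr'ρ : r' < ρ := by
    have := min_le_right r ρ
    linarith
  refine ⟨min 1 (r' / (12 * C + 2)), by positivity, ?_⟩
  intro s hs T x y ξ η ⟨hT, htraj, hx0, hyy0, hξ0, hηη0, _, _⟩ t ht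
  have hs1 : s < 1 := hs.2.trans_le (min_le_left _ _)
  have hs2 : (12 * C + 2) * s < r' := by
    have := hs.2.trans_le (min_le_right _ _)
    rw [lt_div_iff₀ (by positivity)] at this
    linarith
  have hss : 12 * C * s ^ 2 ≤ 12 * C * s := by
    have : s ^ 2 ≤ s := by nlinarith [hs.1]
    have hC' : 0 ≤ 12 * C := by positivity
    exact mul_le_mul_of_nonneg_left this hC'
  have hCs : 0 < C * s := mul_pos hC hs.1
  refine lt_trans (bootstrap_lt (φ := fun t => dist (x t, y t, η t) p₀) (r := r')
    (fun t ht => ContinuousAt.continuousWithinAt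
      (Filter.Tendsto.dist (htraj.continuousAt ht) tendsto_const_nhds))
    (by simpa [hx0, hyy0, hηη0, hp₀] using hr') ?_ t ht) hr'r
  intro τ hτ hclose
  have hsub : ∀ t ∈ Icc 0 τ, t ∈ Icc 0 T := fun t ht => ⟨ht.1, ht.2.trans hτ.2⟩
  have hnear := fun t (ht : t ∈ Icc 0 τ) => hball ((hclose t ht).trans_lt hr'ρ)
  have hpos : ∀ t ∈ Icc 0 τ, 0 ≤ x t := fun t ht => (htraj.mem t (hsub t ht)).1.1
  have hdx : ∀ t ∈ Icc 0 τ, |quadForm (dxA A (x t) (y t)) (η t) (η t)| ≤ B (x t, y t, η t) :=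
    fun t ht => by
      have hm := htraj.mem t (hsub t ht)
      exact abs_quadForm_le (hGG.hderivBound _ hm.1 _ hm.2).1 _
  have hdy : ∀ t ∈ Icc 0 τ, ∀ i,
      |quadForm (dyA A i (x t) (y t)) (η t) (η t)| ≤ B (x t, y t, η t) :=
    fun t ht i => by
      have hm := htraj.mem t (hsub t ht)
      exact abs_quadForm_le ((hGG.hderivBound _ hm.1 _ hm.2).2 i) _
  set q : ℝ → ℝ := fun t => quadForm (A (x t) (y t)) (η t) (η t) +
    1 / 2 * x t * quadForm (dxA A (x t) (y t)) (η t) (η t) with hqdef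
  have hq : ∀ t ∈ Icc 0 τ, 1 / 2 ≤ q t ∧ q t ≤ 2 := fun t ht => by
    obtain ⟨h1, h2, h3, -, -⟩ := hnear t ht
    have h4 := abs_le.1 (hdx t ht)
    have h5 := mul_le_mul_of_nonneg_left h4.1 (hpos t ht)
    have h6 := mul_le_mul_of_nonneg_left h4.2 (hpos t ht)
    simp only at h1 h2 h3
    constructor
    · simp only [hqdef]; linarith
    · simp only [hqdef]; linarith
  have hx : ∀ t ∈ Icc 0 τ, HasDerivAt x (ξ t) t := fun t ht => htraj.hx t (hsub t ht)
  have hξ : ∀ t ∈ Icc 0 τ, HasDerivAt ξ (-(x t * q t)) t := fun t ht => by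
    convert htraj.hxi t (hsub t ht) using 1
    simp only [hqdef]; ring
  have hxb := (oscillator_bounds hs.1.le hτ.1 hx hξ hpos hq hx0 hξ0).1
  have hYb : ∀ i, |y τ i - y 0 i| ≤ 12 * C * s ^ 2 := fun i => by
    refine oscillator_drift hs.1.le hτ.1 hC.le hx hξ hpos hq hx0 hξ0
      (fun t ht => htraj.hy t (hsub t ht) i) fun t ht => ?_
    have h1 : |Y (x t, y t, η t) i| ≤ C := by
      have h2 := (hnear t ht).2.2.2.2
      have h3 := norm_le_pi_norm (Y (x t, y t, η t)) i
      rw [Real.norm_eq_abs] at h3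
      have h4 := hB0 p₀
      linarith
    rw [abs_mul, abs_of_nonneg (sq_nonneg (x t)), mul_comm]
    exact mul_le_mul_of_nonneg_right h1 (sq_nonneg _)
  have hηb : ∀ i, |η τ i - η 0 i| ≤ 12 * C * s ^ 2 := fun i => by
    refine oscillator_drift hs.1.le hτ.1 hC.le hx hξ hpos hq hx0 hξ0
      (fun t ht => htraj.heta t (hsub t ht) i) fun t ht => ?_
    have h1 := hdy t ht i
    have h2 := (hnear t ht).2.2.2.1
    have h3 := norm_nonneg (Y p₀)
    have h4 : |quadForm (dyA A i (x t) (y t)) (η t) (η t)| / 2 ≤ C := by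
      have h5 := abs_nonneg (quadForm (dyA A i (x t) (y t)) (η t) (η t))
      linarith
    have h6 := mul_le_mul_of_nonneg_right h4 (sq_nonneg (x t))
    rw [abs_mul, abs_mul, abs_of_nonneg (sq_nonneg (x t)),
      show |(-(1 / 2) : ℝ)| = 1 / 2 by norm_num]
    linarith
  rw [hp₀, Prod.dist_eq, Prod.dist_eq]
  refine max_lt ?_ (max_lt ?_ ?_)
  · rw [Real.dist_eq, sub_zero, abs_of_nonneg (hpos τ ⟨hτ.1, le_rfl⟩)]
    linarith
  · refine (dist_pi_lt_iff hr').2 fun i => ?_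
    rw [Real.dist_eq, ← hyy0]
    linarith [hYb i, hs.1]
  · refine (dist_pi_lt_iff hr').2 fun i => ?_
    rw [Real.dist_eq, ← hηη0]
    linarith [hηb i, hs.1]

end

/-- boundary determination for gauge-corrected one-forms: if the tangential
components `f₁, …, f_{n-1}` of a smooth one-form with vanishing `dx`-component have vanishing
X-ray transform along all sufficiently short geodesics over `V`, then all normal derivatives
`∂ₓᵏ f_i(0, y)` vanish on `V`. -/
theorem stmt_12 (n : ℕ) (ε : ℝ) (U : Set (Fin (n-1) → ℝ))
    (A : ℝ → (Fin (n-1) → ℝ) → Matrix (Fin (n-1)) (Fin (n-1)) ℝ) (lam Lam : ℝ)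
    (hGG : GasGiantData n ε U A lam Lam)
    (f : Fin (n-1) → ℝ → (Fin (n-1) → ℝ) → ℝ)
    (hf : ∃ W : Set (ℝ × (Fin (n-1) → ℝ)), IsOpen W ∧ Set.Ico (0:ℝ) ε ×ˢ U ⊆ W ∧
      ∀ i, ContDiffOn ℝ (⊤ : ℕ∞) (fun p : ℝ × (Fin (n-1) → ℝ) => f i p.1 p.2) W)
    (V : Set (Fin (n-1) → ℝ)) (hV : IsOpen V) (hVU : V ⊆ U)
    (hmain : ∃ s₀ > (0:ℝ),
      (∀ y₀ ∈ V, ∀ η₀ : Fin (n-1) → ℝ, quadForm (A 0 y₀) η₀ η₀ = 1 →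
        ∀ s ∈ Set.Ioo (0:ℝ) s₀,
          ∃ (T : ℝ) (x : ℝ → ℝ) (y : ℝ → Fin (n-1) → ℝ) (ξ : ℝ → ℝ)
            (η : ℝ → Fin (n-1) → ℝ), IsShortGeo n ε U A y₀ η₀ s T x y ξ η) ∧
      (∀ y₀ ∈ V, ∀ η₀ : Fin (n-1) → ℝ, quadForm (A 0 y₀) η₀ η₀ = 1 →
        ∀ s ∈ Set.Ioo (0:ℝ) s₀,
        ∀ (T : ℝ) (x : ℝ → ℝ) (y : ℝ → Fin (n-1) → ℝ) (ξ : ℝ → ℝ)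
          (η : ℝ → Fin (n-1) → ℝ),
          IsShortGeo n ε U A y₀ η₀ s T x y ξ η →
          (∫ t in (0:ℝ)..T,
            ∑ i, f i (x t) (y t) * ((x t)^2 * ∑ j, A (x t) (y t) i j * η t j)) = 0)) :
    ∀ (k : ℕ) (i : Fin (n-1)), ∀ y₀ ∈ V, dxIter k (f i) 0 y₀ = 0 := by
  obtain ⟨W, hW, hWsub, hfW⟩ := hf
  obtain ⟨s₀, hs₀, hex, hint⟩ := hmain
  intro k
  induction k using Nat.strong_induction_on with
  | _ k ih =>
  intro i₀ y₀ hy₀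
  by_contra hne
  have h0ε : (0 : ℝ) ∈ Ico 0 ε := ⟨le_rfl, hGG.hε.1⟩
  have hdf := fun i => contDiffOn_dxIter hW (hfW i)
  set c : Fin (n-1) → ℝ := fun i => dxIter k (f i) 0 y₀
  set Q : ℝ := quadForm (A 0 y₀) c c with hQdef
  have hQpos : 0 < Q := by
    have h1 : 0 < ∑ i, c i ^ 2 :=
      Finset.sum_pos' (fun i _ => sq_nonneg _) ⟨i₀, Finset.mem_univ _, by positivity⟩
    exact (mul_pos hGG.hlam h1).trans_le (hGG.hposdef 0 h0ε y₀ (hVU hy₀) c).1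
  obtain ⟨a, ha, haQ⟩ : ∃ a > 0, a * a * Q = 1 :=
    ⟨(√Q)⁻¹, inv_pos.2 (Real.sqrt_pos.2 hQpos), by
      rw [← mul_inv, Real.mul_self_sqrt hQpos.le, inv_mul_cancel₀ hQpos.ne']⟩
  set η₀ : Fin (n-1) → ℝ := fun i => a * c i with hη₀def
  have hAη : ∀ i, ∑ j, A 0 y₀ i j * η₀ j = a * ∑ j, A 0 y₀ i j * c j := fun i => by
    rw [Finset.mul_sum]
    exact Finset.sum_congr rfl fun j _ => by simp only [hη₀def]; ring
  have hη₀ : quadForm (A 0 y₀) η₀ η₀ = 1 := by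
    rw [← haQ]
    simp only [hQdef, quadForm, hAη]
    rw [Finset.mul_sum]
    exact Finset.sum_congr rfl fun i _ => by simp only [hη₀def]; ring
  have hc0 : 0 < ∑ i, c i * ∑ j, A 0 y₀ i j * η₀ j := by
    have h1 : ∑ i, c i * ∑ j, A 0 y₀ i j * η₀ j = a * Q := by
      simp only [hQdef, quadForm, hAη]
      rw [Finset.mul_sum]
      exact Finset.sum_congr rfl fun i _ => by ring
    rw [h1]
    exact mul_pos ha hQpos
  -- the pairing of the leading coefficient with the velocity stays positive near the base point
  have hpair : ContinuousAt (fun p : (Fin (n-1) → ℝ) × (Fin (n-1) → ℝ) => ∑ i, p.1 i * p.2 i)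
      (c, fun i => ∑ j, A 0 y₀ i j * η₀ j) := by fun_prop
  obtain ⟨δ, hδ, hpairδ⟩ := Metric.eventually_nhds_iff.1 (hpair.eventually_const_lt hc0)
  obtain ⟨ρ₁, hρ₁, hvel⟩ := Metric.continuousAt_iff.1
    (hGG.continuousAt_mulVec h0ε (hVU hy₀) η₀) δ hδ
  have hcoef : ContinuousAt (fun (p : ℝ × (Fin (n-1) → ℝ)) (i : Fin (n-1)) =>
      dxIter k (f i) p.1 p.2) (0, y₀) :=
    continuousAt_pi.2 fun i =>
      (hdf i k).continuousOn.continuousAt (hW.mem_nhds (hWsub ⟨h0ε, hVU hy₀⟩))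
  obtain ⟨ρ₂, hρ₂, hder⟩ := Metric.continuousAt_iff.1 hcoef δ hδ
  obtain ⟨ρ₃, hρ₃, hballV⟩ := Metric.isOpen_iff.1 hV y₀ hy₀
  obtain ⟨s₁, hs₁, hconf⟩ := hGG.exists_confined (hVU hy₀) hη₀
    (lt_min hρ₁ (lt_min hρ₂ hρ₃))
  set s : ℝ := min s₀ s₁ / 2 with hsdef
  have hmin : 0 < min s₀ s₁ := lt_min hs₀ hs₁
  have hs_s₀ : s ∈ Ioo 0 s₀ := ⟨by positivity, by linarith [min_le_left s₀ s₁]⟩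
  have hs_s₁ : s ∈ Ioo 0 s₁ := ⟨by positivity, by linarith [min_le_right s₀ s₁]⟩
  obtain ⟨T, x, y, ξ, η, hgeo⟩ := hex y₀ hy₀ η₀ hη₀ s hs_s₀
  have hzero := hint y₀ hy₀ η₀ hη₀ s hs_s₀ T x y ξ η hgeo
  have hnear := hconf s hs_s₁ T x y ξ η hgeo
  obtain ⟨hT, htraj, -, -, -, -, -, hxpos⟩ := hgeo
  refine hzero.not_gt ?_
  refine intervalIntegral.intervalIntegral_pos_of_pos_on ?_ ?_ hT
  · refine ContinuousOn.intervalIntegrable ?_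
    rw [uIcc_of_le hT.le]
    refine fun t ht => ContinuousAt.continuousWithinAt ?_
    have hm := htraj.mem t ht
    have hc := htraj.continuousAt ht
    have hv : ContinuousAt (fun t i => ∑ j, A (x t) (y t) i j * η t j) t :=
      Filter.Tendsto.comp (hGG.continuousAt_mulVec hm.1 hm.2 (η t)) hc
    have hxc : ContinuousAt x t := (htraj.hx t ht).continuousAt
    have hyc : ContinuousAt y t := continuousAt_pi.2 fun i => (htraj.hy t ht i).continuousAt
    refine tendsto_finsetSum _ fun i _ => ?_
    have hfc : ContinuousAt (fun t => f i (x t) (y t)) t :=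
      Filter.Tendsto.comp
        ((hfW i).continuousOn.continuousAt (hW.mem_nhds (hWsub ⟨hm.1, hm.2⟩)))
        (hxc.prodMk hyc)
    exact hfc.mul ((hxc.pow 2).mul (continuousAt_pi.1 hv i))
  · intro t ht
    have htc := Ioo_subset_Icc_self ht
    have hxt := hxpos t ht
    have hm := htraj.mem t htc
    have hn := hnear t htc
    rw [lt_min_iff, lt_min_iff] at hn
    obtain ⟨hn₁, hn₂, hn₃⟩ := hn
    rw [Prod.dist_eq, Prod.dist_eq] at hn₂ hn₃
    simp only [max_lt_iff] at hn₂ hn₃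
    have hyV : y t ∈ V := hballV hn₃.2.1
    have htaylor : ∀ i, ∃ z ∈ Ioc 0 (x t),
        f i (x t) (y t) = dxIter k (f i) z (y t) * (x t ^ k / (k.factorial : ℝ)) := fun i =>
      exists_eq_mul_pow_div_factorial k (fun j z => dxIter j (f i) z (y t)) (x t) hxt
        (fun j z hz => hasDerivAt_dxF hW (hdf i j)
          (hWsub ⟨⟨hz.1, hz.2.trans_lt hm.1.2⟩, hm.2⟩))
        (fun j hj => ih j hj i (y t) hyV)
    choose z hz hfz using htaylor
    have hzc : dist (fun i => dxIter k (f i) (z i) (y t)) c < δ := by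
      refine (dist_pi_lt_iff hδ).2 fun i => ?_
      have hzi : dist (z i, y t) ((0 : ℝ), y₀) < ρ₂ := by
        rw [Prod.dist_eq]
        refine max_lt (lt_of_le_of_lt ?_ hn₂.1) hn₂.2.1
        rw [Real.dist_eq, Real.dist_eq, sub_zero, sub_zero, abs_of_pos (hz i).1,
          abs_of_pos hxt]
        exact (hz i).2
      exact (dist_pi_lt_iff hδ).1 (hder hzi) i
    have hpos := hpairδ (y := (_, _)) ((Prod.dist_eq).trans_lt (max_lt hzc (hvel hn₁)))
    have hsum : ∑ i, f i (x t) (y t) * ((x t)^2 * ∑ j, A (x t) (y t) i j * η t j) =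
        (x t ^ k / (k.factorial : ℝ) * x t ^ 2) *
          ∑ i, dxIter k (f i) (z i) (y t) * ∑ j, A (x t) (y t) i j * η t j := by
      rw [Finset.mul_sum]
      exact Finset.sum_congr rfl fun i _ => by rw [hfz i]; ring
    rw [hsum]
    exact mul_pos (by positivity) hpos
end
end

section
/- Gauge correction: let f₀ be a real-valued function on [0,ε) × U that extends to a C^∞ function on an open neighborhood of [0,ε) × U in ℝ × ℝ^{n-1}. Then there exists a function q on [0,ε) × U, extending to a C^∞ function on an open neighborhood of [0,ε) × U, such that: q(0,y) = 0 for all y ∈ U; ∂_x q(x,y) = f₀(x,y) whenever x ≤ ε/2; q(x,y) = 0 whenever x ≥ 3ε/4; and for every Hamiltonian trajectory on an interval [0,T] with x(0) = x(T) = 0 one has ∫₀^T [∂_x q(x(t),y(t)) ξ(t) + x(t)² ⟨∇_y q(x(t),y(t)), A(x(t),y(t)) η(t)⟩] dt = 0, i.e. the geodesic X-ray transform of the exact one-form dq vanishes on all boundary-to-boundary geodesics. -/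
open Set

noncomputable section

open Topology MeasureTheory

section ParametricIntegral

variable {E : Type*} [NormedAddCommGroup E]

/-- A continuous function near a compact segment `{p} × [0,1]` is bounded on a tube around it. -/
lemma exists_nhds_bound_of_continuousOn {F : Type*} [NormedAddCommGroup F]
    {f : E × ℝ → F} {V : Set (E × ℝ)} (hV : IsOpen V) (hf : ContinuousOn f V) {p₀ : E}
    (hp : ∀ t ∈ Icc (0:ℝ) 1, (p₀, t) ∈ V) :
    ∃ u ∈ 𝓝 p₀, ∃ C : ℝ, ∀ p ∈ u, ∀ t ∈ Icc (0:ℝ) 1, (p, t) ∈ V ∧ ‖f (p, t)‖ ≤ C := by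
  have hcont : ContinuousOn (fun t => f (p₀, t)) (Icc (0:ℝ) 1) :=
    hf.comp (by fun_prop) hp
  obtain ⟨C, hC⟩ := isCompact_Icc.exists_bound_of_continuousOn hcont
  have hopen : IsOpen (V ∩ (fun z => ‖f z‖) ⁻¹' Iio (C + 1)) :=
    hf.norm.isOpen_inter_preimage hV isOpen_Iio
  obtain ⟨u, w, hu, -, hpu, hw, huw⟩ := generalized_tube_lemma (isCompact_singleton (x := p₀))
    (isCompact_Icc (a := (0:ℝ)) (b := 1)) hopen (by
      rintro ⟨p, t⟩ ⟨rfl, ht⟩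
      exact ⟨hp t ht, (hC t ht).trans_lt (lt_add_one C)⟩)
  refine ⟨u, hu.mem_nhds (hpu rfl), C + 1, fun p hpu t ht => ?_⟩
  have h := huw (mk_mem_prod hpu (hw ht))
  exact ⟨h.1, le_of_lt h.2⟩

lemma isOpen_setOf_forall_Icc_mem {V : Set (E × ℝ)} (hV : IsOpen V) :
    IsOpen {p : E | ∀ t ∈ Icc (0:ℝ) 1, (p, t) ∈ V} := by
  rw [isOpen_iff_mem_nhds]
  intro p hp
  obtain ⟨u, hu, C, h⟩ := exists_nhds_bound_of_continuousOn (f := fun _ => (0:ℝ)) hV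
    continuousOn_const hp
  exact Filter.mem_of_superset hu fun q hq t ht => (h q hq t ht).1

lemma intervalIntegrable_slice {F : Type*} [NormedAddCommGroup F]
    {f : E × ℝ → F} {V : Set (E × ℝ)} (hf : ContinuousOn f V) {p : E}
    (hp : ∀ t ∈ Icc (0:ℝ) 1, (p, t) ∈ V) :
    IntervalIntegrable (fun t => f (p, t)) volume 0 1 := by
  apply ContinuousOn.intervalIntegrable
  rw [uIcc_of_le zero_le_one]
  exact hf.comp (by fun_prop) hp

lemma mem_Icc_of_mem_uIoc {t : ℝ} (ht : t ∈ uIoc (0:ℝ) 1) : t ∈ Icc (0:ℝ) 1 := by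
  rw [uIoc_of_le zero_le_one] at ht
  exact Ioc_subset_Icc_self ht

lemma continuousOn_integral_slice {F : Type*} [NormedAddCommGroup F] [NormedSpace ℝ F]
    {f : E × ℝ → F} {V : Set (E × ℝ)} (hV : IsOpen V) (hf : ContinuousOn f V) :
    ContinuousOn (fun p => ∫ t in (0:ℝ)..1, f (p, t))
      {p | ∀ t ∈ Icc (0:ℝ) 1, (p, t) ∈ V} := by
  intro p₀ hp₀
  obtain ⟨u, hu, C, h⟩ := exists_nhds_bound_of_continuousOn hV hf hp₀
  apply ContinuousAt.continuousWithinAt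
  apply intervalIntegral.continuousAt_of_dominated_interval (bound := fun _ => C)
  · filter_upwards [hu] with p hpu
    exact (intervalIntegrable_slice hf fun t ht => (h p hpu t ht).1).def'.aestronglyMeasurable
  · filter_upwards [hu] with p hpu
    exact Filter.Eventually.of_forall fun t ht => (h p hpu t (mem_Icc_of_mem_uIoc ht)).2
  · exact intervalIntegrable_const
  · refine Filter.Eventually.of_forall fun t ht => ?_
    have := hf.continuousAt (hV.mem_nhds (hp₀ t (mem_Icc_of_mem_uIoc ht)))
    exact this.comp (f := fun p : E => (p, t)) (by fun_prop)

lemma hasFDerivAt_integral_slice [NormedSpace ℝ E] {F : Type*} [NormedAddCommGroup F] [NormedSpace ℝ F]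
    {f : E × ℝ → F} {V : Set (E × ℝ)} (hV : IsOpen V) (hf : ContDiffOn ℝ 1 f V)
    {p₀ : E} (hp₀ : ∀ t ∈ Icc (0:ℝ) 1, (p₀, t) ∈ V) :
    HasFDerivAt (fun p => ∫ t in (0:ℝ)..1, f (p, t))
      (∫ t in (0:ℝ)..1, (fderiv ℝ f (p₀, t)).comp (ContinuousLinearMap.inl ℝ E ℝ)) p₀ := by
  have hf' : ContinuousOn
      (fun z => (fderiv ℝ f z).comp (ContinuousLinearMap.inl ℝ E ℝ)) V :=
    (hf.continuousOn_fderiv_of_isOpen hV le_rfl).clm_comp continuousOn_const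
  obtain ⟨u, hu, C, h⟩ := exists_nhds_bound_of_continuousOn hV hf' hp₀
  apply intervalIntegral.hasFDerivAt_integral_of_dominated_of_fderiv_le hu
    (bound := fun _ => C)
    (F' := fun p t => (fderiv ℝ f (p, t)).comp (ContinuousLinearMap.inl ℝ E ℝ))
  · filter_upwards [hu] with p hpu
    exact (intervalIntegrable_slice hf.continuousOn
      fun t ht => (h p hpu t ht).1).def'.aestronglyMeasurable
  · exact intervalIntegrable_slice hf.continuousOn hp₀
  · exact (intervalIntegrable_slice hf' hp₀).def'.aestronglyMeasurable
  · exact Filter.Eventually.of_forall fun t ht p hpu => (h p hpu t (mem_Icc_of_mem_uIoc ht)).2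
  · exact intervalIntegrable_const
  · refine Filter.Eventually.of_forall fun t ht p hpu => ?_
    have hd : HasFDerivAt f (fderiv ℝ f (p, t)) (p, t) :=
      ((hf.differentiableOn one_ne_zero).differentiableAt
        (hV.mem_nhds (h p hpu t (mem_Icc_of_mem_uIoc ht)).1)).hasFDerivAt
    exact hd.comp p (hasFDerivAt_prodMk_left p t)

end ParametricIntegral

/-- Differentiation under the integral sign, at every finite order. -/
lemma contDiffOn_nat_integral_slice {E : Type} [NormedAddCommGroup E] [NormedSpace ℝ E]
    {V : Set (E × ℝ)} (hV : IsOpen V) (m : ℕ) :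
    ∀ {F : Type} [NormedAddCommGroup F] [NormedSpace ℝ F] {f : E × ℝ → F},
      ContDiffOn ℝ m f V → ContDiffOn ℝ m (fun p => ∫ t in (0:ℝ)..1, f (p, t))
        {p | ∀ t ∈ Icc (0:ℝ) 1, (p, t) ∈ V} := by
  induction m with
  | zero =>
    intro F _ _ f hf
    rw [Nat.cast_zero, contDiffOn_zero] at hf ⊢
    exact continuousOn_integral_slice hV hf
  | succ m ih =>
    intro F _ _ f hf
    have h1 : ContDiffOn ℝ 1 f V := hf.of_le (by simp)
    have hfd : ContDiffOn ℝ m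
        (fun z => (fderiv ℝ f z).comp (ContinuousLinearMap.inl ℝ E ℝ)) V :=
      (hf.fderiv_of_isOpen hV (by simp)).clm_comp contDiffOn_const
    rw [Nat.cast_add, Nat.cast_one,
      contDiffOn_succ_iff_fderiv_of_isOpen (isOpen_setOf_forall_Icc_mem hV)]
    refine ⟨fun p hp => (hasFDerivAt_integral_slice hV h1
      hp).differentiableAt.differentiableWithinAt, by simp, ?_⟩
    exact (ih hfd).congr fun p hp => (hasFDerivAt_integral_slice hV h1 hp).fderiv

lemma contDiffOn_integral_slice {E F : Type} [NormedAddCommGroup E] [NormedSpace ℝ E]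
    [NormedAddCommGroup F] [NormedSpace ℝ F] {V : Set (E × ℝ)} (hV : IsOpen V)
    {f : E × ℝ → F} (hf : ContDiffOn ℝ (⊤ : ℕ∞) f V) :
    ContDiffOn ℝ (⊤ : ℕ∞) (fun p => ∫ t in (0:ℝ)..1, f (p, t))
      {p | ∀ t ∈ Icc (0:ℝ) 1, (p, t) ∈ V} :=
  contDiffOn_infty.2 fun m => contDiffOn_nat_integral_slice hV m (contDiffOn_infty.1 hf m)

/-- The primitive `∫₀ˣ f(s, y) ds` of a smooth function is smooth in `(x, y)`. -/
lemma exists_contDiffOn_primitive {m : ℕ} {ε : ℝ} {U : Set (Fin m → ℝ)}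
    {f : ℝ → (Fin m → ℝ) → ℝ} {W : Set (ℝ × (Fin m → ℝ))} (hW : IsOpen W)
    (hsub : Ico (0:ℝ) ε ×ˢ U ⊆ W)
    (hf : ContDiffOn ℝ (⊤ : ℕ∞) (fun p : ℝ × (Fin m → ℝ) => f p.1 p.2) W) :
    ∃ S : Set (ℝ × (Fin m → ℝ)), IsOpen S ∧ Ico (0:ℝ) ε ×ˢ U ⊆ S ∧
      ContDiffOn ℝ (⊤ : ℕ∞) (fun p : ℝ × (Fin m → ℝ) => ∫ s in (0:ℝ)..p.1, f s p.2) S := by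
  have hφ : ContDiff ℝ (⊤ : ℕ∞)
      (fun z : (ℝ × (Fin m → ℝ)) × ℝ => ((z.1.1 * z.2, z.1.2) : ℝ × (Fin m → ℝ))) := by
    fun_prop
  have hV := hW.preimage hφ.continuous
  refine ⟨_, isOpen_setOf_forall_Icc_mem hV, ?_, ?_⟩
  · rintro ⟨x, y⟩ ⟨hx, hy⟩ t ht
    refine hsub ⟨⟨mul_nonneg hx.1 ht.1, ?_⟩, hy⟩
    exact (mul_le_of_le_one_right hx.1 ht.2).trans_lt hx.2
  · have hg : ContDiffOn ℝ (⊤ : ℕ∞)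
        (fun z : (ℝ × (Fin m → ℝ)) × ℝ => z.1.1 * f (z.1.1 * z.2) z.1.2)
        ((fun z : (ℝ × (Fin m → ℝ)) × ℝ => ((z.1.1 * z.2, z.1.2) : ℝ × (Fin m → ℝ))) ⁻¹' W) := by
      refine ContDiffOn.mul (ContDiff.contDiffOn (by fun_prop)) ?_
      exact hf.comp hφ.contDiffOn fun z hz => hz
    refine (contDiffOn_integral_slice hV hg).congr fun p _ => ?_
    have := intervalIntegral.mul_integral_comp_mul_left (a := 0) (b := 1)
      (f := fun s => f s p.2) (c := p.1)
    simp only [mul_zero, mul_one] at this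
    exact this.symm.trans (intervalIntegral.integral_const_mul _ _).symm

lemma hasDerivAt_primitive_fst {m : ℕ} {ε : ℝ} {U : Set (Fin m → ℝ)}
    {f : ℝ → (Fin m → ℝ) → ℝ} {W : Set (ℝ × (Fin m → ℝ))} (hW : IsOpen W)
    (hsub : Ico (0:ℝ) ε ×ˢ U ⊆ W)
    (hf : ContinuousOn (fun p : ℝ × (Fin m → ℝ) => f p.1 p.2) W)
    {x : ℝ} (hx : x ∈ Ico (0:ℝ) ε) {y : Fin m → ℝ} (hy : y ∈ U) :
    HasDerivAt (fun x' => ∫ s in (0:ℝ)..x', f s y) (f x y) x := by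
  have hι : Continuous fun s : ℝ => (s, y) := by fun_prop
  have hc : ContinuousOn (fun s => f s y) ((fun s : ℝ => (s, y)) ⁻¹' W) :=
    hf.comp hι.continuousOn fun s hs => hs
  have ho := hW.preimage hι
  have hxW : x ∈ (fun s : ℝ => (s, y)) ⁻¹' W := hsub ⟨hx, hy⟩
  apply intervalIntegral.integral_hasDerivAt_right
  · apply ContinuousOn.intervalIntegrable
    rw [uIcc_of_le hx.1]
    exact hc.mono fun s hs => hsub ⟨⟨hs.1, hs.2.trans_lt hx.2⟩, hy⟩
  · exact hc.stronglyMeasurableAtFilter ho x hxW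
  · exact hc.continuousAt (ho.mem_nhds hxW)

/-- The differential of `q` expressed through its partial derivatives. -/
lemma fderiv_apply_eq_partials {m : ℕ} {q : ℝ → (Fin m → ℝ) → ℝ} {x : ℝ} {y : Fin m → ℝ}
    (hq : DifferentiableAt ℝ (fun p : ℝ × (Fin m → ℝ) => q p.1 p.2) (x, y))
    (a : ℝ) (v : Fin m → ℝ) :
    fderiv ℝ (fun p : ℝ × (Fin m → ℝ) => q p.1 p.2) (x, y) (a, v)
      = dxF q x y * a + ∑ i, v i * dyF q i x y := by
  set L := fderiv ℝ (fun p : ℝ × (Fin m → ℝ) => q p.1 p.2) (x, y) with hL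
  have hx : dxF q x y = L (1, 0) := by
    have h1 : HasDerivAt (fun x' : ℝ => (x', y)) ((1 : ℝ), (0 : Fin m → ℝ)) x :=
      (hasDerivAt_id x).prodMk (hasDerivAt_const x y)
    exact (hq.hasFDerivAt.comp_hasDerivAt x h1).deriv
  have hy : ∀ i, dyF q i x y = L (0, Pi.single i 1) := by
    intro i
    have h1 : HasDerivAt (fun s : ℝ => (x, Function.update y i s))
        ((0 : ℝ), (Pi.single i (1 : ℝ) : Fin m → ℝ)) (y i) :=
      (hasDerivAt_const (y i) x).prodMk (hasDerivAt_update y i (y i))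
    have h2 : HasFDerivAt (fun p : ℝ × (Fin m → ℝ) => q p.1 p.2) L
        (x, Function.update y i (y i)) := by
      rw [Function.update_eq_self]; exact hq.hasFDerivAt
    exact (h2.comp_hasDerivAt (y i) h1).deriv
  have hdec : ((a, v) : ℝ × (Fin m → ℝ))
      = a • ((1 : ℝ), (0 : Fin m → ℝ)) + ∑ i, v i • ((0 : ℝ), (Pi.single i (1 : ℝ) : Fin m → ℝ)) := by
    ext j
    · simp [Prod.fst_sum]
    · simp [Prod.snd_sum, Finset.sum_apply, Pi.single_apply]
  rw [hdec, map_add, map_sum, hx]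
  simp only [hy, map_smul, smul_eq_mul, mul_comm]

/-- The integral of an exact one-form along a `C¹` curve is the difference of the boundary
values of its potential. -/
lemma integral_partials_eq_sub {m : ℕ} {q : ℝ → (Fin m → ℝ) → ℝ} {S : Set (ℝ × (Fin m → ℝ))}
    (hS : IsOpen S) (hq : ContDiffOn ℝ 1 (fun p : ℝ × (Fin m → ℝ) => q p.1 p.2) S)
    {T : ℝ} (hT : 0 ≤ T) {x a : ℝ → ℝ} {y v : ℝ → Fin m → ℝ}
    (hmem : ∀ t ∈ Icc 0 T, (x t, y t) ∈ S)
    (hx : ∀ t ∈ Icc 0 T, HasDerivAt x (a t) t) (hy : ∀ t ∈ Icc 0 T, HasDerivAt y (v t) t)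
    (ha : ContinuousOn a (Icc 0 T)) (hv : ContinuousOn v (Icc 0 T)) :
    ∫ t in (0:ℝ)..T, (dxF q (x t) (y t) * a t + ∑ i, v t i * dyF q i (x t) (y t))
      = q (x T) (y T) - q (x 0) (y 0) := by
  have hdiff : ∀ t ∈ Icc 0 T,
      DifferentiableAt ℝ (fun p : ℝ × (Fin m → ℝ) => q p.1 p.2) (x t, y t) := fun t ht =>
    (hq.differentiableOn one_ne_zero).differentiableAt (hS.mem_nhds (hmem t ht))
  have hγ : ContinuousOn (fun t => (x t, y t)) (Icc 0 T) := fun t ht =>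
    ((hx t ht).continuousAt.prodMk (hy t ht).continuousAt).continuousWithinAt
  have hint : ContinuousOn
      (fun t => fderiv ℝ (fun p : ℝ × (Fin m → ℝ) => q p.1 p.2) (x t, y t) (a t, v t))
      (Icc 0 T) :=
    ((hq.continuousOn_fderiv_of_isOpen hS le_rfl).comp hγ hmem).clm_apply (ha.prodMk hv)
  have hcongr : EqOn
      (fun t => fderiv ℝ (fun p : ℝ × (Fin m → ℝ) => q p.1 p.2) (x t, y t) (a t, v t))
      (fun t => dxF q (x t) (y t) * a t + ∑ i, v t i * dyF q i (x t) (y t)) (Icc 0 T) :=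
    fun t ht => fderiv_apply_eq_partials (hdiff t ht) (a t) (v t)
  rw [← uIcc_of_le hT] at hcongr hint
  rw [← intervalIntegral.integral_congr hcongr]
  refine intervalIntegral.integral_eq_sub_of_hasDerivAt (f := fun t => q (x t) (y t))
    (fun t ht => ?_) hint.intervalIntegrable
  rw [uIcc_of_le hT] at ht
  exact (hdiff t ht).hasFDerivAt.comp_hasDerivAt t ((hx t ht).prodMk (hy t ht))

/-- gauge correction: given a smooth `dx`-component `f₀`, there is a smooth
potential `q` vanishing on the boundary with `∂ₓ q = f₀` near the boundary, `q = 0` away from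
the boundary, and with the X-ray transform of `dq` vanishing on all boundary-to-boundary
Hamiltonian trajectories. -/
theorem stmt_13 (n : ℕ) (ε : ℝ) (U : Set (Fin (n-1) → ℝ))
    (A : ℝ → (Fin (n-1) → ℝ) → Matrix (Fin (n-1)) (Fin (n-1)) ℝ) (lam Lam : ℝ)
    (hGG : GasGiantData n ε U A lam Lam)
    (f0 : ℝ → (Fin (n-1) → ℝ) → ℝ)
    (hf0 : ∃ W : Set (ℝ × (Fin (n-1) → ℝ)), IsOpen W ∧ Set.Ico (0:ℝ) ε ×ˢ U ⊆ W ∧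
      ContDiffOn ℝ (⊤ : ℕ∞) (fun p : ℝ × (Fin (n-1) → ℝ) => f0 p.1 p.2) W) :
    ∃ q : ℝ → (Fin (n-1) → ℝ) → ℝ,
      (∃ W : Set (ℝ × (Fin (n-1) → ℝ)), IsOpen W ∧ Set.Ico (0:ℝ) ε ×ˢ U ⊆ W ∧
        ContDiffOn ℝ (⊤ : ℕ∞) (fun p : ℝ × (Fin (n-1) → ℝ) => q p.1 p.2) W) ∧
      (∀ y ∈ U, q 0 y = 0) ∧
      (∀ x ∈ Set.Ico (0:ℝ) ε, ∀ y ∈ U, x ≤ ε/2 → dxF q x y = f0 x y) ∧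
      (∀ x ∈ Set.Ico (0:ℝ) ε, ∀ y ∈ U, 3*ε/4 ≤ x → q x y = 0) ∧
      (∀ (T : ℝ), 0 ≤ T →
        ∀ (x : ℝ → ℝ) (y : ℝ → Fin (n-1) → ℝ) (ξ : ℝ → ℝ) (η : ℝ → Fin (n-1) → ℝ),
          IsHamTraj n ε U A (Set.Icc 0 T) x y ξ η → x 0 = 0 → x T = 0 →
          (∫ t in (0:ℝ)..T, dxF q (x t) (y t) * ξ t
              + (x t)^2 * ∑ i, (∑ j, A (x t) (y t) i j * η t j) * dyF q i (x t) (y t))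
            = 0) := by
  obtain ⟨W, hW, hsub, hf⟩ := hf0
  obtain ⟨S, hS, hsubS, hP⟩ := exists_contDiffOn_primitive hW hsub hf
  have hε : 0 < ε := hGG.hε.1
  let χ : ℝ → ℝ := fun x => Real.smoothTransition ((3*ε/4 - x) / (ε/8))
  have hχ : ContDiff ℝ (⊤ : ℕ∞) χ :=
    Real.smoothTransition.contDiff.comp (by fun_prop)
  let q : ℝ → (Fin (n-1) → ℝ) → ℝ := fun x y => χ x * ∫ s in (0:ℝ)..x, f0 s y
  have hq : ContDiffOn ℝ (⊤ : ℕ∞) (fun p : ℝ × (Fin (n-1) → ℝ) => q p.1 p.2) S :=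
    ContDiffOn.mul (hχ.comp contDiff_fst).contDiffOn hP
  have hq0 : ∀ y, q 0 y = 0 := fun y => by simp [q]
  refine ⟨q, ⟨S, hS, hsubS, hq⟩, fun y _ => hq0 y, ?_, ?_, ?_⟩
  · intro x hx y hy hxε
    have hev : (fun x' => q x' y) =ᶠ[𝓝 x] fun x' => ∫ s in (0:ℝ)..x', f0 s y := by
      filter_upwards [Iio_mem_nhds (show x < 5*ε/8 by linarith)] with x' hx'
      have : χ x' = 1 := by
        apply Real.smoothTransition.one_of_one_le
        rw [le_div_iff₀ (by positivity)]
        linarith [mem_Iio.1 hx']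
      simp [q, this]
    exact hev.deriv_eq.trans (hasDerivAt_primitive_fst hW hsub hf.continuousOn hx hy).deriv
  · intro x _ y _ hxε
    have : χ x = 0 := by
      apply Real.smoothTransition.zero_of_nonpos
      exact div_nonpos_of_nonpos_of_nonneg (by linarith) (by positivity)
    simp [q, this]
  · intro T hT x y ξ η hγ hx0 hxT
    obtain ⟨WA, -, hsubA, hA⟩ := hGG.hsmooth
    have hy : ∀ t ∈ Icc 0 T, HasDerivAt y
        (fun i => (x t)^2 * ∑ j, A (x t) (y t) i j * η t j) t := fun t ht =>
      hasDerivAt_pi.2 fun i => hγ.hy t ht i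
    have hxc : ContinuousOn x (Icc 0 T) := fun t ht =>
      (hγ.hx t ht).continuousAt.continuousWithinAt
    have hyc : ContinuousOn y (Icc 0 T) := fun t ht =>
      (hy t ht).continuousAt.continuousWithinAt
    have hξc : ContinuousOn ξ (Icc 0 T) := fun t ht =>
      (hγ.hxi t ht).continuousAt.continuousWithinAt
    have hηc : ∀ j, ContinuousOn (fun t => η t j) (Icc 0 T) := fun j t ht =>
      (hγ.heta t ht j).continuousAt.continuousWithinAt
    have hAc : ∀ i j, ContinuousOn (fun t => A (x t) (y t) i j) (Icc 0 T) := fun i j =>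
      (hA i j).continuousOn.comp (hxc.prodMk hyc) fun t ht => hsubA (hγ.mem t ht)
    have hvc : ContinuousOn (fun t i => (x t)^2 * ∑ j, A (x t) (y t) i j * η t j) (Icc 0 T) :=
      continuousOn_pi.2 fun i => (hxc.pow 2).mul
        (continuousOn_finsetSum _ fun j _ => (hAc i j).mul (hηc j))
    have key := integral_partials_eq_sub hS (hq.of_le (by simp)) hT
      (fun t ht => hsubS (hγ.mem t ht)) hγ.hx hy hξc hvc
    rw [hxT, hx0, hq0, hq0, sub_zero] at key
    refine Eq.trans (intervalIntegral.integral_congr fun t _ => ?_) key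
    simp only [mul_assoc, ← Finset.mul_sum]
end
end

section
/- Let k ≥ 1 be an integer, K > 0, and let f̄₀, …, f̄_{n−1} be real-valued functions on [0,ε) × U extending to C^∞ functions on an open neighborhood of [0,ε) × U, with all their values and all their first-order partial derivatives bounded in absolute value by K. Set f_μ(x,y) = x^k f̄_μ(x,y) for μ = 0,…,n−1, and define λf(x,y,ξ,η) = f₀(x,y) ξ + x² ⟨A(x,y)(f₁,…,f_{n−1})(x,y), η⟩ (the one-form f identified with a function on the cotangent bundle). Then there is a constant C > 0, depending only on n, λ, Λ, K, k, such that for every (x,y,ξ,η) ∈ (0,ε) × U × ℝ × ℝ^{n-1} lying on the unit cosphere bundle, i.e. satisfying ξ² + x²⟨A(x,y)η, η⟩ = 1, one has |λf(x,y,ξ,η)| ≤ C x^k, and the Euclidean norm of the full gradient of λf with respect to all 2n variables (x, y, ξ, η) at that point is at most C x^{k−1}. -/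
open Set

noncomputable section

/-- The one-form `f = x^k f̄₀ dx + Σᵢ x^k f̄ᵢ dyⁱ` identified with the function
`λf(x,y,ξ,η) = f₀ ξ + x² ⟨A(x,y)(f₁,…,f_{n−1}), η⟩` on the cotangent bundle. -/
def lamF {m : ℕ} (A : ℝ → (Fin m → ℝ) → Matrix (Fin m) (Fin m) ℝ) (k : ℕ)
    (fbar0 : ℝ → (Fin m → ℝ) → ℝ) (fbarT : Fin m → ℝ → (Fin m → ℝ) → ℝ)
    (x : ℝ) (y : Fin m → ℝ) (ξ : ℝ) (η : Fin m → ℝ) : ℝ :=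
  x^k * fbar0 x y * ξ + x^2 * quadForm (A x y) (fun i => x^k * fbarT i x y) η

theorem hasDerivAt_partials {m : ℕ} {g : ℝ → (Fin m → ℝ) → ℝ} {W : Set (ℝ × (Fin m → ℝ))}
    (hW : IsOpen W) (hg : ContDiffOn ℝ (⊤ : ℕ∞) (fun p : ℝ × (Fin m → ℝ) => g p.1 p.2) W)
    {x : ℝ} {y : Fin m → ℝ} (hp : (x, y) ∈ W) :
    HasDerivAt (fun x' => g x' y) (dxF g x y) x ∧
      ∀ i, HasDerivAt (fun s => g x (Function.update y i s)) (dyF g i x y) (y i) := by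
  have hd : DifferentiableAt ℝ (fun p : ℝ × (Fin m → ℝ) => g p.1 p.2) (x, y) :=
    (hg.contDiffAt (hW.mem_nhds hp)).differentiableAt (by simp)
  refine ⟨DifferentiableAt.hasDerivAt ?_, fun i => DifferentiableAt.hasDerivAt ?_⟩
  · exact hd.comp (f := fun x' : ℝ => (x', y)) x (by fun_prop)
  · have hu : DifferentiableAt ℝ (fun s : ℝ => (x, Function.update y i s)) (y i) :=
      (differentiableAt_const x).prodMk (hasDerivAt_update y i (y i)).differentiableAt
    refine DifferentiableAt.comp (g := fun p : ℝ × (Fin m → ℝ) => g p.1 p.2) (y i) ?_ hu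
    simpa using hd

/-- Product rule for the pairing `∑ᵢ (∑ⱼ aᵢⱼ fⱼ) ηᵢ` along a curve. -/
theorem hasDerivAt_quadForm {m : ℕ} {a : ℝ → Matrix (Fin m) (Fin m) ℝ} {f : ℝ → Fin m → ℝ}
    {a' : Matrix (Fin m) (Fin m) ℝ} {f' : Fin m → ℝ} {t : ℝ} (η : Fin m → ℝ)
    (ha : ∀ i j, HasDerivAt (fun s => a s i j) (a' i j) t)
    (hf : ∀ j, HasDerivAt (fun s => f s j) (f' j) t) :
    HasDerivAt (fun s => quadForm (a s) (f s) η)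
      (∑ i, (∑ j, (a' i j * f t j + a t i j * f' j)) * η i) t := by
  unfold quadForm
  exact HasDerivAt.fun_sum fun i _ =>
    (HasDerivAt.fun_sum fun j _ => (ha i j).mul (hf j)).mul_const (η i)

theorem abs_sum_le_card_mul {m : ℕ} {c : Fin m → ℝ} {M : ℝ} (hc : ∀ j, |c j| ≤ M) :
    |∑ j, c j| ≤ m * M := by
  calc |∑ j, c j| ≤ ∑ j, |c j| := Finset.abs_sum_le_sum_abs _ _
    _ ≤ ∑ _j : Fin m, M := Finset.sum_le_sum fun j _ => hc j
    _ = m * M := by simp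

theorem abs_mul_sum_sum_le {m : ℕ} {c : Fin m → Fin m → ℝ} {η : Fin m → ℝ} {x M R : ℝ}
    (hM : 0 ≤ M) (hc : ∀ i j, |c i j| ≤ M) (hη : ∀ i, |x * η i| ≤ R) :
    |x * ∑ i, (∑ j, c i j) * η i| ≤ (m : ℝ) ^ 2 * M * R := by
  have h : x * ∑ i, (∑ j, c i j) * η i = ∑ i, (∑ j, c i j) * (x * η i) := by
    rw [Finset.mul_sum]
    exact Finset.sum_congr rfl fun i _ => by ring
  rw [h]
  calc |∑ i, (∑ j, c i j) * (x * η i)| ≤ m * (m * M * R) := by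
        refine abs_sum_le_card_mul fun i => ?_
        rw [abs_mul]
        exact mul_le_mul (abs_sum_le_card_mul (hc i)) (hη i) (abs_nonneg _) (by positivity)
    _ = (m : ℝ) ^ 2 * M * R := by ring

theorem abs_entry_le_of_elliptic {m : ℕ} {M : Matrix (Fin m) (Fin m) ℝ} {lam Lam : ℝ}
    (hlam : 0 < lam) (hs : M.IsSymm)
    (h : ∀ v : Fin m → ℝ, lam * (∑ i, v i ^ 2) ≤ quadForm M v v ∧
      quadForm M v v ≤ Lam * (∑ i, v i ^ 2)) (i j : Fin m) : |M i j| ≤ Lam := by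
  have hdiag : ∀ i, lam ≤ M i i ∧ M i i ≤ Lam := fun i => by
    simpa [quadForm, Pi.single_apply] using h (Pi.single i 1)
  rcases eq_or_ne i j with rfl | hij
  · rw [abs_le]
    constructor <;> linarith [hdiag i]
  · have hq : quadForm M (Pi.single i 1 + Pi.single j 1) (Pi.single i 1 + Pi.single j 1)
        = M i i + M j j + 2 * M i j := by
      have : M j i = M i j := hs.apply i j
      simp [quadForm, Pi.single_apply, mul_add, Finset.sum_add_distrib]
      linarith
    have hn : ∑ l, (Pi.single i 1 + Pi.single j 1 : Fin m → ℝ) l ^ 2 = 2 := by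
      have : ∀ l, (Pi.single i 1 + Pi.single j 1 : Fin m → ℝ) l ^ 2
          = (if l = i then 1 else 0) + (if l = j then 1 else 0) := fun l => by
        by_cases h1 : l = i
        · subst h1
          simp [hij]
        · simp [Pi.single_apply, h1]
      simp only [this, Finset.sum_add_distrib, Finset.sum_ite_eq', Finset.mem_univ, if_true]
      norm_num
    have hv := h (Pi.single i 1 + Pi.single j 1)
    rw [hq, hn] at hv
    rw [abs_le]
    constructor <;> linarith [hdiag i, hdiag j]

theorem lamF_eq {m : ℕ} (A : ℝ → (Fin m → ℝ) → Matrix (Fin m) (Fin m) ℝ) (k : ℕ)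
    (fbar0 : ℝ → (Fin m → ℝ) → ℝ) (fbarT : Fin m → ℝ → (Fin m → ℝ) → ℝ)
    (x : ℝ) (y : Fin m → ℝ) (ξ : ℝ) (η : Fin m → ℝ) :
    lamF A k fbar0 fbarT x y ξ η =
      x ^ k * (fbar0 x y * ξ) + x ^ (k + 2) * quadForm (A x y) (fun i => fbarT i x y) η := by
  have h : quadForm (A x y) (fun i => x ^ k * fbarT i x y) η
      = x ^ k * quadForm (A x y) (fun i => fbarT i x y) η := by
    simp only [quadForm, Finset.mul_sum, Finset.sum_mul]
    exact Finset.sum_congr rfl fun i _ => Finset.sum_congr rfl fun j _ => by ring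
  rw [lamF, h]
  ring

theorem sqrt_sum_sq_le {m : ℕ} {a c B : ℝ} {b d : Fin m → ℝ} (hB : 0 ≤ B) (ha : |a| ≤ B)
    (hb : ∀ i, |b i| ≤ B) (hc : |c| ≤ B) (hd : ∀ i, |d i| ≤ B) :
    √(a ^ 2 + ∑ i, b i ^ 2 + c ^ 2 + ∑ i, d i ^ 2) ≤ (2 * m + 2) * B := by
  have hsq : ∀ {t : ℝ}, |t| ≤ B → t ^ 2 ≤ B ^ 2 := fun h => sq_le_sq' (abs_le.1 h).1 (abs_le.1 h).2
  have hsum : ∀ {t : Fin m → ℝ}, (∀ i, |t i| ≤ B) → ∑ i, t i ^ 2 ≤ m * B ^ 2 := fun h =>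
    (Finset.sum_le_sum fun i _ => hsq (h i)).trans (by simp)
  refine Real.sqrt_le_iff.2 ⟨by positivity, ?_⟩
  have h1 : (2 * (m : ℝ) + 2) * B ^ 2 ≤ ((2 * m + 2) * B) ^ 2 := by
    rw [mul_pow]
    gcongr
    have : (0 : ℝ) ≤ m := by positivity
    nlinarith
  linarith [hsq ha, hsq hc, hsum hb, hsum hd]

/-- for `f = x^k f̄` with `f̄` smooth with values and first derivatives bounded
by `K`, on the unit cosphere bundle one has `|λf| ≤ C x^k` and the Euclidean norm of the full
gradient of `λf` in all `2n` variables is at most `C x^{k−1}`; `C` depends only on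
`n`, `lam`, `Lam`, `K`, `k`. -/
theorem stmt_16 (n : ℕ) (hn : 2 ≤ n) (lam Lam : ℝ) (hlam : 0 < lam) (hll : lam ≤ Lam)
    (K : ℝ) (hK : 0 < K) (k : ℕ) (hk : 1 ≤ k) :
    ∃ C > (0:ℝ),
      ∀ (ε : ℝ) (U : Set (Fin (n-1) → ℝ))
        (A : ℝ → (Fin (n-1) → ℝ) → Matrix (Fin (n-1)) (Fin (n-1)) ℝ),
        GasGiantData n ε U A lam Lam →
        ∀ (fbar0 : ℝ → (Fin (n-1) → ℝ) → ℝ) (fbarT : Fin (n-1) → ℝ → (Fin (n-1) → ℝ) → ℝ),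
          (∃ W : Set (ℝ × (Fin (n-1) → ℝ)), IsOpen W ∧ Set.Ico (0:ℝ) ε ×ˢ U ⊆ W ∧
            ContDiffOn ℝ (⊤ : ℕ∞) (fun p : ℝ × (Fin (n-1) → ℝ) => fbar0 p.1 p.2) W ∧
            ∀ i, ContDiffOn ℝ (⊤ : ℕ∞) (fun p : ℝ × (Fin (n-1) → ℝ) => fbarT i p.1 p.2) W) →
          (∀ x ∈ Set.Ico (0:ℝ) ε, ∀ y ∈ U,
            |fbar0 x y| ≤ K ∧ |dxF fbar0 x y| ≤ K ∧ (∀ i, |dyF fbar0 i x y| ≤ K) ∧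
            ∀ i, |fbarT i x y| ≤ K ∧ |dxF (fbarT i) x y| ≤ K ∧
              ∀ j, |dyF (fbarT i) j x y| ≤ K) →
          ∀ x ∈ Set.Ioo (0:ℝ) ε, ∀ y ∈ U, ∀ (ξ : ℝ) (η : Fin (n-1) → ℝ),
            ξ^2 + x^2 * quadForm (A x y) η η = 1 →
            |lamF A k fbar0 fbarT x y ξ η| ≤ C * x^k ∧
            Real.sqrt (
              (deriv (fun x' => lamF A k fbar0 fbarT x' y ξ η) x)^2
              + (∑ i, (deriv (fun s => lamF A k fbar0 fbarT x (Function.update y i s) ξ η)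
                  (y i))^2)
              + (deriv (fun ξ' => lamF A k fbar0 fbarT x y ξ' η) ξ)^2
              + (∑ i, (deriv (fun s => lamF A k fbar0 fbarT x y ξ (Function.update η i s))
                  (η i))^2))
              ≤ C * x^(k-1) := by
  set R : ℝ := 1 + 1 / lam
  set Q : ℝ := ((n - 1 : ℕ) : ℝ) ^ 2 * (Lam * K) * R with hQ
  have hLam : 0 < Lam := hlam.trans_le hll
  have hR1 : 1 ≤ R := by
    have : 0 < 1 / lam := by positivity
    linarith
  have hQ0 : 0 ≤ Q := by positivity
  set B : ℝ := (k + 1) * K + (k + 4) * Q + (n - 1 : ℕ) * (Lam * K)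
  have hB : 0 < B := by positivity
  have hkQ : 0 ≤ (k : ℝ) * Q := by positivity
  have hkK : 0 ≤ (k : ℝ) * K := by positivity
  have hmL : 0 ≤ ((n - 1 : ℕ) : ℝ) * (Lam * K) := by positivity
  refine ⟨(2 * (n - 1 : ℕ) + 2) * B, by positivity, ?_⟩
  rintro ε U A hA fbar0 fbarT ⟨W, hW, hUW, hf0, hfT⟩ hbd x ⟨hx0, hxε⟩ y hy ξ η hcos
  have hxI : x ∈ Ico (0 : ℝ) ε := ⟨hx0.le, hxε⟩
  have hx1 : x ≤ 1 := hxε.le.trans hA.hε.2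
  obtain ⟨b0, b0x, b0y, bT⟩ := hbd x hxI y hy
  have hell := hA.hposdef x hxI y hy
  have hAb := abs_entry_le_of_elliptic hlam (hA.hsymm x hxI y hy) hell
  obtain ⟨hAx, hAy⟩ := hA.hderivBound x hxI y hy
  obtain ⟨V, hV, hUV, hAs⟩ := hA.hsmooth
  have hqη : lam * ∑ i, η i ^ 2 ≤ quadForm (A x y) η η := (hell η).1
  have hS : 0 ≤ ∑ i, η i ^ 2 := Finset.sum_nonneg fun i _ => sq_nonneg _
  have hξ : |ξ| ≤ 1 := by
    rw [← sq_le_one_iff_abs_le_one]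
    nlinarith [mul_nonneg (sq_nonneg x) ((mul_nonneg hlam.le hS).trans hqη)]
  have hη : ∀ i, |x * η i| ≤ R := fun i => by
    have h1 : η i ^ 2 ≤ ∑ i, η i ^ 2 :=
      Finset.single_le_sum (f := fun i => η i ^ 2) (fun i _ => sq_nonneg _) (Finset.mem_univ i)
    have h2 : x ^ 2 * (lam * η i ^ 2) ≤ 1 := by
      have : x ^ 2 * (lam * η i ^ 2) ≤ x ^ 2 * quadForm (A x y) η η := by
        gcongr
        exact (mul_le_mul_of_nonneg_left h1 hlam.le).trans hqη
      nlinarith [sq_nonneg ξ]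
    have h3 : (x * η i) ^ 2 ≤ 1 / lam := by
      rw [le_div_iff₀ hlam]
      nlinarith
    nlinarith [sq_abs (x * η i), sq_nonneg (|x * η i| - 1), abs_nonneg (x * η i)]
  have hprod : ∀ {a b α β : ℝ}, 0 ≤ α → |a| ≤ α → |b| ≤ β → |a * b| ≤ α * β :=
    fun hα ha hb => by
      rw [abs_mul]
      exact mul_le_mul ha hb (abs_nonneg _) hα
  have hpow : ∀ {p : ℕ} {t M : ℝ}, k - 1 ≤ p → |t| ≤ M → |x ^ p * t| ≤ M * x ^ (k - 1) :=
    fun {p t M} hp ht => by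
      rw [abs_mul, abs_of_nonneg (pow_nonneg hx0.le p), mul_comm]
      exact mul_le_mul ht (pow_le_pow_of_le_one hx0.le hx1 hp) (by positivity)
        ((abs_nonneg t).trans ht)
  have hP : |x * quadForm (A x y) (fun i => fbarT i x y) η| ≤ Q :=
    abs_mul_sum_sum_le (by positivity) (fun i j => hprod hLam.le (hAb i j) (bT j).1) hη
  have hDP : ∀ (a' : Matrix (Fin (n - 1)) (Fin (n - 1)) ℝ) (f' : Fin (n - 1) → ℝ), (∀ i j, |a' i j| ≤ Lam) →
      (∀ j, |f' j| ≤ K) →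
      |x * ∑ i, (∑ j, (a' i j * fbarT j x y + A x y i j * f' j)) * η i| ≤ 2 * Q :=
    fun a' f' ha hf => by
      refine (abs_mul_sum_sum_le (M := 2 * (Lam * K)) (by positivity) (fun i j => ?_) hη).trans_eq
        (by rw [hQ]; ring)
      linarith [abs_add_le (a' i j * fbarT j x y) (A x y i j * f' j),
        hprod hLam.le (ha i j) (bT j).1, hprod hLam.le (hAb i j) (hf j)]
  have h0ξ : |fbar0 x y * ξ| ≤ K := by simpa using hprod hK.le b0 hξ
  have d0 := hasDerivAt_partials hW hf0 (hUW ⟨hxI, hy⟩)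
  have dT := fun i => hasDerivAt_partials hW (hfT i) (hUW ⟨hxI, hy⟩)
  have dA := fun i j => hasDerivAt_partials (g := fun x y => A x y i j) hV (hAs i j)
    (hUV ⟨hxI, hy⟩)
  have hBx : 0 ≤ B * x ^ (k - 1) := by positivity
  constructor
  · rw [lamF_eq]
    have e : x ^ k * (fbar0 x y * ξ) + x ^ (k + 2) * quadForm (A x y) (fun i => fbarT i x y) η
        = x ^ k * (fbar0 x y * ξ + x * (x * quadForm (A x y) (fun i => fbarT i x y) η)) := by ring
    rw [e, abs_mul, abs_of_pos (pow_pos hx0 k), mul_comm]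
    gcongr
    have h1 : |x * (x * quadForm (A x y) (fun i => fbarT i x y) η)| ≤ 1 * Q :=
      hprod zero_le_one (by rwa [abs_of_pos hx0]) hP
    have h2 : 1 * B ≤ (2 * (n - 1 : ℕ) + 2) * B := by
      gcongr
      linarith [(Nat.cast_nonneg (n - 1) : (0 : ℝ) ≤ (n - 1 : ℕ))]
    linarith [abs_add_le (fbar0 x y * ξ) (x * (x * quadForm (A x y) (fun i => fbarT i x y) η))]
  · rw [mul_assoc]
    refine sqrt_sum_sq_le hBx ?_ (fun l => ?_) ?_ (fun l => ?_)
    · set q := quadForm (A x y) (fun i => fbarT i x y) η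
      set D := ∑ i, (∑ j, (dxA A x y i j * fbarT j x y + A x y i j * dxF (fbarT j) x y)) * η i
        with hD
      have hd : HasDerivAt (fun x' => lamF A k fbar0 fbarT x' y ξ η)
          (x ^ (k - 1) * (k * (fbar0 x y * ξ)) + x ^ k * (dxF fbar0 x y * ξ)
            + x ^ k * ((k + 2) * (x * q)) + x ^ (k + 1) * (x * D)) x := by
        simp only [lamF_eq]
        refine (((hasDerivAt_pow k x).mul (d0.1.mul_const ξ)).add
          ((hasDerivAt_pow (k + 2) x).mul
            (hasDerivAt_quadForm (a := fun x' => A x' y) (f := fun x' i => fbarT i x' y)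
              (a' := dxA A x y) (f' := fun i => dxF (fbarT i) x y) η
              (fun i j => (dA i j).1) (fun j => (dT j).1)))).congr_deriv ?_
        rw [← hD, show k + 2 - 1 = k + 1 by omega]
        push_cast
        ring
      rw [hd.deriv]
      have e1 := hpow (p := k - 1) le_rfl
        (hprod (Nat.cast_nonneg k) (abs_of_nonneg (Nat.cast_nonneg (α := ℝ) k)).le h0ξ)
      have e2 := hpow (p := k) (by omega) (hprod hK.le b0x hξ)
      have e3 := hpow (p := k) (by omega)
        (hprod (α := k + 2) (a := k + 2) (by positivity) (abs_of_nonneg (by positivity)).le hP)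
      have e4 := hpow (p := k + 1) (by omega)
        (hDP (dxA A x y) (fun i => dxF (fbarT i) x y) hAx fun j => (bT j).2.1)
      calc _ ≤ k * K * x ^ (k - 1) + K * 1 * x ^ (k - 1) + (k + 2) * Q * x ^ (k - 1)
            + 2 * Q * x ^ (k - 1) :=
          (abs_add_le _ _).trans (add_le_add ((abs_add_le _ _).trans
            (add_le_add ((abs_add_le _ _).trans (add_le_add e1 e2)) e3)) e4)
        _ = (k * K + K + (k + 2) * Q + 2 * Q) * x ^ (k - 1) := by ring
        _ ≤ B * x ^ (k - 1) := by
          gcongr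
          linarith
    · set D := ∑ i, (∑ j, (dyA A l x y i j * fbarT j x y
        + A x y i j * dyF (fbarT j) l x y)) * η i with hD
      have hd : HasDerivAt (fun s => lamF A k fbar0 fbarT x (Function.update y l s) ξ η)
          (x ^ k * (dyF fbar0 l x y * ξ) + x ^ (k + 1) * (x * D)) (y l) := by
        simp only [lamF_eq]
        refine ((((d0.2 l).mul_const ξ).const_mul (x ^ k)).add
          ((hasDerivAt_quadForm (a := fun s => A x (Function.update y l s))
            (f := fun s i => fbarT i x (Function.update y l s))
            (a' := dyA A l x y) (f' := fun i => dyF (fbarT i) l x y) η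
            (fun i j => (dA i j).2 l) (fun j => (dT j).2 l)).const_mul
              (x ^ (k + 2)))).congr_deriv ?_
        simp only [Function.update_eq_self]
        rw [← hD]
        ring
      rw [hd.deriv]
      have e1 := hpow (p := k) (by omega) (hprod hK.le (b0y l) hξ)
      have e2 := hpow (p := k + 1) (by omega)
        (hDP (dyA A l x y) (fun i => dyF (fbarT i) l x y) (hAy l) fun j => (bT j).2.2 l)
      calc _ ≤ K * 1 * x ^ (k - 1) + 2 * Q * x ^ (k - 1) :=
          (abs_add_le _ _).trans (add_le_add e1 e2)
        _ = (K + 2 * Q) * x ^ (k - 1) := by ring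
        _ ≤ B * x ^ (k - 1) := by
          gcongr
          linarith
    · have hd : HasDerivAt (fun ξ' => lamF A k fbar0 fbarT x y ξ' η) (x ^ k * fbar0 x y) ξ := by
        simpa [lamF] using ((hasDerivAt_id ξ).const_mul (x ^ k * fbar0 x y)).add_const
          (x ^ 2 * quadForm (A x y) (fun i => x ^ k * fbarT i x y) η)
      rw [hd.deriv]
      refine (hpow (by omega) b0).trans ?_
      gcongr
      linarith
    · have hd : HasDerivAt (fun s => lamF A k fbar0 fbarT x y ξ (Function.update η l s))
          (x ^ (k + 2) * ∑ j, A x y l j * fbarT j x y) (η l) := by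
        simp only [lamF_eq, quadForm]
        have hs : HasDerivAt (fun s => ∑ i, (∑ j, A x y i j * fbarT j x y) *
            Function.update η l s i) (∑ i, (∑ j, A x y i j * fbarT j x y) *
            (Pi.single l 1 : Fin (n - 1) → ℝ) i) (η l) :=
          HasDerivAt.fun_sum fun i _ =>
            ((hasDerivAt_pi.1 (hasDerivAt_update η l (η l))) i).const_mul _
        simpa [Pi.single_apply] using (hs.const_mul (x ^ (k + 2))).const_add
          (x ^ k * (fbar0 x y * ξ))
      rw [hd.deriv]
      refine (hpow (by omega)
        (abs_sum_le_card_mul fun j => hprod hLam.le (hAb l j) (bT j).1)).trans ?_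
      gcongr
      linarith
end
end

section
/- There exist ε′ > 0 and C > 0, depending only on n, λ, Λ, with the following property. Let k ≥ 0 be an integer, K > 0, and let f₀, …, f_{n−1} be real-valued functions on [0,ε) × U with |f_μ(x,y)| ≤ K x^k for all (x,y) and all μ. Let t ↦ (x(t),y(t),ξ(t),η(t)) be a Hamiltonian trajectory on [0,T] of unit speed (ξ² + x²⟨A(x,y)η,η⟩ = 1) with x(0) = x₀ ∈ (0,ε′), ξ(0) ≤ 0, x(t) > 0 for t ∈ [0,T), x(T) = 0, and ⟨A(x(t),y(t))η(t), η(t)⟩ ≤ 2 for all t ∈ [0,T]. Then the integral of the one-form along the descending geodesic satisfies |∫₀^T [f₀(x(t),y(t)) ξ(t) + x(t)² ⟨A(x(t),y(t))(f₁,…,f_{n−1})(x(t),y(t)), η(t)⟩] dt| ≤ C K x₀^{k+1}. -/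
open Set

noncomputable section

/-- Arithmetic-mean form of the Cauchy-Schwarz inequality for a positive semidefinite form. -/
theorem abs_quadForm_le_s17 {m : ℕ} {M : Matrix (Fin m) (Fin m) ℝ} (hM : M.IsSymm)
    (hpos : ∀ v, 0 ≤ quadForm M v v) (v w : Fin m → ℝ) :
    |quadForm M v w| ≤ (quadForm M v v + quadForm M w w) / 2 := by
  have hswap : quadForm M w v = quadForm M v w := by
    simp only [quadForm, Finset.sum_mul]
    rw [Finset.sum_comm]
    refine Finset.sum_congr rfl fun i _ => Finset.sum_congr rfl fun j _ => ?_
    rw [hM.apply i j]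
    ring
  have hadd : quadForm M (v + w) (v + w)
      = quadForm M v v + quadForm M v w + quadForm M w v + quadForm M w w := by
    simp only [quadForm, Pi.add_apply, mul_add, add_mul, Finset.sum_add_distrib]
    ring
  have hsub : quadForm M (v - w) (v - w)
      = quadForm M v v - quadForm M v w - quadForm M w v + quadForm M w w := by
    simp only [quadForm, Pi.sub_apply, mul_sub, sub_mul, Finset.sum_sub_distrib]
    ring
  have h1 := hpos (v + w)
  have h2 := hpos (v - w)
  rw [abs_le]
  constructor <;> linarith

/-- The pairing of a vector with entries of size at most `c` against a vector of bounded energy. -/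
theorem abs_quadForm_le_of_abs_le {m : ℕ} {M : Matrix (Fin m) (Fin m) ℝ} (hM : M.IsSymm)
    {L E c : ℝ} (hL : 0 ≤ L)
    (hbound : ∀ v, 0 ≤ quadForm M v v ∧ quadForm M v v ≤ L * ∑ i, v i ^ 2)
    {v w : Fin m → ℝ} (hv : ∀ i, |v i| ≤ c) (hw : quadForm M w w ≤ E) (hc : 0 ≤ c) :
    |quadForm M v w| ≤ c * ((L * m + E) / 2) := by
  obtain ⟨u, hu, rfl⟩ : ∃ u : Fin m → ℝ, (∀ i, |u i| ≤ 1) ∧ v = fun i => c * u i := by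
    rcases hc.eq_or_lt with rfl | hc
    · exact ⟨0, by simp, funext fun i => by simpa using hv i⟩
    · refine ⟨fun i => v i / c, fun i => ?_, funext fun i => by field_simp⟩
      rw [abs_div, abs_of_pos hc, div_le_one hc]
      exact hv i
  have hscale : quadForm M (fun i => c * u i) w = c * quadForm M u w := by
    simp only [quadForm, Finset.mul_sum, Finset.sum_mul]
    refine Finset.sum_congr rfl fun i _ => Finset.sum_congr rfl fun j _ => ?_
    ring
  have hsum : ∑ i, u i ^ 2 ≤ m := by
    calc ∑ i, u i ^ 2 ≤ ∑ _i : Fin m, (1 : ℝ) :=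
          Finset.sum_le_sum fun i _ => (sq_le_one_iff_abs_le_one _).2 (hu i)
      _ = m := by simp
  rw [hscale, abs_mul, abs_of_nonneg hc]
  refine mul_le_mul_of_nonneg_left ?_ hc
  have h1 := abs_quadForm_le_s17 hM (fun v => (hbound v).1) u w
  have h2 := (hbound u).2
  have h3 := mul_le_mul_of_nonneg_left hsum hL
  linarith

/-- A function with derivative at most `-1/2` on `[0,τ)` lies below the line of slope `-1/2`. -/
theorem le_sub_div_two_of_deriv_le {x ξ : ℝ → ℝ} {τ : ℝ}
    (hx : ∀ t ∈ Icc 0 τ, HasDerivAt x (ξ t) t) (hξ : ∀ t ∈ Ico 0 τ, ξ t ≤ -1 / 2) :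
    ∀ t ∈ Icc 0 τ, x t ≤ x 0 - t / 2 := by
  have hB : ∀ t, HasDerivAt (fun t => x 0 - t / 2) (-1 / 2) t := fun t => by
    simpa [neg_div] using ((hasDerivAt_id t).div_const 2).const_sub (x 0)
  intro t ht
  exact image_le_of_deriv_right_le_deriv_boundary (a := 0) (b := τ)
    (fun t ht => (hx t ht).continuousAt.continuousWithinAt)
    (fun t ht => (hx t (Ico_subset_Icc_self ht)).hasDerivWithinAt) (by simp)
    (fun t _ => (hB t).continuousAt.continuousWithinAt)
    (fun t _ => (hB t).hasDerivWithinAt) hξ ht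

/-- A unit-speed curve starting downwards below height `1/2` descends with speed at least `1/2`. -/
theorem velocity_lt_of_energy {x ξ : ℝ → ℝ} {T : ℝ}
    (hx : ∀ t ∈ Icc 0 T, HasDerivAt x (ξ t) t) (hξ : ContinuousOn ξ (Icc 0 T))
    (hx_nonneg : ∀ t ∈ Icc 0 T, 0 ≤ x t)
    (henergy : ∀ t ∈ Icc 0 T, 1 ≤ ξ t ^ 2 + 2 * x t ^ 2)
    (hx0 : x 0 < 1 / 2) (hξ0 : ξ 0 ≤ 0) :
    ∀ t ∈ Icc 0 T, ξ t < -1 / 2 := by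
  by_contra! hcon
  obtain ⟨t₁, ht₁, hξt₁⟩ := hcon
  have hcompact : IsCompact (Icc 0 T ∩ ξ ⁻¹' Ici (-1 / 2)) :=
    isCompact_Icc.of_isClosed_subset
      (hξ.preimage_isClosed_of_isClosed isClosed_Icc isClosed_Ici) inter_subset_left
  obtain ⟨τ, ⟨hτ, hξτ⟩, hleast⟩ := hcompact.exists_isLeast ⟨t₁, ht₁, hξt₁⟩
  have hξτ : -1 / 2 ≤ ξ τ := hξτ
  have hsub : Icc 0 τ ⊆ Icc 0 T := Icc_subset_Icc_right hτ.2
  have hbefore : ∀ t ∈ Ico 0 τ, ξ t ≤ -1 / 2 := fun t ht => by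
    by_contra! h
    exact ht.2.not_ge (hleast ⟨hsub (Ico_subset_Icc_self ht), h.le⟩)
  have hxτ := le_sub_div_two_of_deriv_le (fun t ht => hx t (hsub ht)) hbefore τ ⟨hτ.1, le_rfl⟩
  have hτpos : 0 < ξ τ := by
    have h1 := henergy τ hτ
    have h2 := hx_nonneg τ hτ
    have h3 : x τ < 1 / 2 := by linarith [hτ.1]
    by_contra! h
    nlinarith
  obtain ⟨s, hs, hξs⟩ := intermediate_value_Icc hτ.1 (hξ.mono hsub) ⟨hξ0, hτpos.le⟩
  have hsτ : s = τ := le_antisymm hs.2 (hleast ⟨hsub hs, by simp [hξs]; norm_num⟩)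
  rw [hsτ] at hξs
  linarith

/-- if the components of a one-form satisfy `|f_μ(x,y)| ≤ K x^k`, then the
integral of the one-form along any unit-speed descending geodesic starting at height `x₀`
is bounded by `C K x₀^{k+1}`; `ε'`, `C` depend only on `n`, `lam`, `Lam`. -/
theorem stmt_17 (n : ℕ) (hn : 2 ≤ n) (lam Lam : ℝ) (hlam : 0 < lam) (hll : lam ≤ Lam) :
    ∃ ε' > (0:ℝ), ∃ C > (0:ℝ),
      ∀ (ε : ℝ) (U : Set (Fin (n-1) → ℝ))
        (A : ℝ → (Fin (n-1) → ℝ) → Matrix (Fin (n-1)) (Fin (n-1)) ℝ),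
        GasGiantData n ε U A lam Lam →
        ∀ (k : ℕ) (K : ℝ), 0 < K →
        ∀ (f0 : ℝ → (Fin (n-1) → ℝ) → ℝ) (fT : Fin (n-1) → ℝ → (Fin (n-1) → ℝ) → ℝ),
          (∀ x ∈ Set.Ico (0:ℝ) ε, ∀ y ∈ U,
            |f0 x y| ≤ K * x^k ∧ ∀ i, |fT i x y| ≤ K * x^k) →
        ∀ (T : ℝ), 0 ≤ T →
        ∀ (x : ℝ → ℝ) (y : ℝ → Fin (n-1) → ℝ) (ξ : ℝ → ℝ) (η : ℝ → Fin (n-1) → ℝ),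
          IsHamTraj n ε U A (Set.Icc 0 T) x y ξ η →
          (∀ t ∈ Set.Icc (0:ℝ) T,
            ξ t ^ 2 + (x t)^2 * quadForm (A (x t) (y t)) (η t) (η t) = 1) →
          x 0 ∈ Set.Ioo (0:ℝ) (min ε' ε) → ξ 0 ≤ 0 →
          (∀ t ∈ Set.Ico (0:ℝ) T, 0 < x t) → x T = 0 →
          (∀ t ∈ Set.Icc (0:ℝ) T, quadForm (A (x t) (y t)) (η t) (η t) ≤ 2) →
          |∫ t in (0:ℝ)..T, f0 (x t) (y t) * ξ t
              + (x t)^2 * quadForm (A (x t) (y t)) (fun i => fT i (x t) (y t)) (η t)|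
            ≤ C * K * (x 0)^(k+1) := by
  set M : ℝ := (Lam * ((n - 1 : ℕ) : ℝ) + 2) / 2
  have hM0 : 0 ≤ M :=
    div_nonneg (add_nonneg (mul_nonneg (hlam.le.trans hll) (Nat.cast_nonneg _)) zero_le_two)
      zero_le_two
  refine ⟨1 / 2, by norm_num, 2 * (1 + M), by positivity, ?_⟩
  intro ε U A hA k K hK f0 fT hf T hT x y ξ η hH hunit hx0 hξ0 _ hxT hq
  have hform : ∀ t ∈ Icc 0 T, ∀ v : Fin (n - 1) → ℝ, 0 ≤ quadForm (A (x t) (y t)) v v ∧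
      quadForm (A (x t) (y t)) v v ≤ Lam * ∑ i, v i ^ 2 := fun t ht v => by
    obtain ⟨h1, h2⟩ := hA.hposdef _ (hH.mem t ht).1 _ (hH.mem t ht).2 v
    exact ⟨(mul_nonneg hlam.le (Finset.sum_nonneg fun i _ => sq_nonneg _)).trans h1, h2⟩
  have hξ : ∀ t ∈ Icc 0 T, ξ t ≤ -1 / 2 := fun t ht =>
    (velocity_lt_of_energy hH.hx (fun t ht => (hH.hxi t ht).continuousAt.continuousWithinAt)
      (fun t ht => (hH.mem t ht).1.1)
      (fun t ht => by nlinarith [hunit t ht, hq t ht, sq_nonneg (x t)])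
      (hx0.2.trans_le (min_le_left _ _)) hξ0 t ht).le
  have hdesc := le_sub_div_two_of_deriv_le hH.hx fun t ht => hξ t (Ico_subset_Icc_self ht)
  have hTle : T ≤ 2 * x 0 := by linarith [hdesc T ⟨hT, le_rfl⟩]
  have hbound : ∀ t ∈ Icc 0 T, |f0 (x t) (y t) * ξ t
      + x t ^ 2 * quadForm (A (x t) (y t)) (fun i => fT i (x t) (y t)) (η t)|
      ≤ K * x 0 ^ k * (1 + M) := fun t ht => by
    obtain ⟨hxt, hyt⟩ := hH.mem t ht
    obtain ⟨hf0, hfT⟩ := hf _ hxt _ hyt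
    have hc : 0 ≤ K * x t ^ k := mul_nonneg hK.le (pow_nonneg hxt.1 k)
    have hquad := abs_quadForm_le_of_abs_le (hA.hsymm _ hxt _ hyt) (hlam.le.trans hll)
      (hform t ht) hfT (hq t ht) hc
    have hξ1 : |ξ t| ≤ 1 := by
      rw [← sq_le_one_iff_abs_le_one]
      linarith [hunit t ht, mul_nonneg (sq_nonneg (x t)) (hform t ht (η t)).1]
    have hx1 : x t ^ 2 ≤ 1 := pow_le_one₀ hxt.1 (hxt.2.le.trans hA.hε.2)
    have hmono : K * x t ^ k ≤ K * x 0 ^ k :=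
      mul_le_mul_of_nonneg_left
        (pow_le_pow_left₀ hxt.1 (by linarith [hdesc t ht, ht.1]) k) hK.le
    calc _ ≤ |f0 (x t) (y t)| * |ξ t|
          + x t ^ 2 * |quadForm (A (x t) (y t)) (fun i => fT i (x t) (y t)) (η t)| := by
          refine (abs_add_le _ _).trans_eq ?_
          rw [abs_mul, abs_mul, abs_of_nonneg (sq_nonneg (x t))]
      _ ≤ K * x t ^ k * 1 + 1 * (K * x t ^ k * M) := by gcongr
      _ = K * x t ^ k * (1 + M) := by ring
      _ ≤ K * x 0 ^ k * (1 + M) := by gcongr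
  have hint := intervalIntegral.norm_integral_le_of_norm_le_const (a := 0) (b := T)
    (f := fun t => f0 (x t) (y t) * ξ t
      + x t ^ 2 * quadForm (A (x t) (y t)) (fun i => fT i (x t) (y t)) (η t))
    fun t ht => hbound t (Ioc_subset_Icc_self (by rwa [uIoc_of_le hT] at ht))
  rw [Real.norm_eq_abs, sub_zero, abs_of_nonneg hT] at hint
  have hx0' : 0 ≤ x 0 := hx0.1.le
  calc _ ≤ K * x 0 ^ k * (1 + M) * T := hint
    _ ≤ K * x 0 ^ k * (1 + M) * (2 * x 0) := by gcongr
    _ = 2 * (1 + M) * K * x 0 ^ (k + 1) := by ring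
end
end
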